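/- Let N ≥ 3, m > 1, and let ρ satisfy the weight condition. Let u₀ ∈ L¹_ρ(ℝ^N) ∩ L^∞(ℝ^N) with u₀ ≥ 0, and let u be a non-negative weak energy solution of the Cauchy problem ρ u_t = Δ(u^m), u(0) = u₀, which in addition (as the constructed solution of Proposition 3.2 does) satisfies: u_t ∈ L^∞_loc((0,∞); L¹_ρ(ℝ^N)); the Aronson–Bénilan inequality ρ u_t ≥ −ρ u/((m−1)t) a.e. in ℝ^N×(0,∞); the smoothing estimate ‖u(t)‖_{L^∞(ℝ^N)} ≤ K t^{−λ} ‖u₀‖_{L¹_ρ(ℝ^N)}^{θλ} for all t > 0; and mass conservation ∫_{ℝ^N} u(t) ρ dx = ∫_{ℝ^N} u₀ ρ dx for all t > 0. Then for all 0 < t₀ < t₁ and for almost every x₀ ∈ ℝ^N (the admissible set possibly depending on t₀, t₁), ∫_{ℝ^N} [u(x,t₀) − u(x,t₁)] G(x,x₀) ρ(x) dx ≤ (m−1) · t₁^{m/(m−1)} · t₀^{−1/(m−1)} · u^m(x₀,t₁), where G(x,x₀) = (N(N−2)α(N))^{−1}|x−x₀|^{2−N} is the Green function of −Δ on ℝ^N.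 -/

import Mathlib

open MeasureTheory Set Metric Filter
open scoped ENNReal Topology

noncomputable section

abbrev Eu (N : ℕ) := EuclideanSpace ℝ (Fin N)

/-- Signed power `a^q = |a|^{q-1} a`. -/
def spow (a q : ℝ) : ℝ := |a| ^ (q - 1) * a

/-- The weight condition \eqref{weight-cond}: `ρ` is measurable and
`C̲ (1+|x|)^{-γ} ≤ ρ(x) ≤ C̄ |x|^{-γ}` for a.e. `x`, with `γ ∈ [0,2)` and `0 < C̲ < C̄`. -/
def WeightCond (N : ℕ) (γ Cl Cu : ℝ) (ρ : Eu N → ℝ) : Prop :=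
  Measurable ρ ∧ 0 ≤ γ ∧ γ < 2 ∧ 0 < Cl ∧ Cl < Cu ∧
    ∀ᵐ x ∂(volume : Measure (Eu N)), Cl * (1 + ‖x‖) ^ (-γ) ≤ ρ x ∧ ρ x ≤ Cu * ‖x‖ ^ (-γ)

/-- Time derivative `ψ_t` of a space-time test function. -/
def ptder {N : ℕ} (ψ : Eu N × ℝ → ℝ) (p : Eu N × ℝ) : ℝ := fderiv ℝ ψ p (0, 1)

/-- Spatial Laplacian `Δψ` of a space-time test function. -/
def lapX {N : ℕ} (ψ : Eu N × ℝ → ℝ) (p : Eu N × ℝ) : ℝ :=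
  ∑ i : Fin N, fderiv ℝ (fun q => fderiv ℝ ψ q (EuclideanSpace.single i 1, 0)) p
    (EuclideanSpace.single i 1, 0)

/-- Very weak solution of `ρ u_t = Δ(u^m)` in `Ω × (τ₁, τ₂)` (Definitions 2.6 / 2.8). -/
structure VWS {N : ℕ} (ρ : Eu N → ℝ) (m : ℝ) (Ω : Set (Eu N)) (τ₁ τ₂ : ℝ)
    (u : Eu N → ℝ → ℝ) : Prop where
  aemeas : AEMeasurable (fun p : Eu N × ℝ => u p.1 p.2)
    (volume.restrict (Ω ×ˢ Ioo τ₁ τ₂))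
  locint : ∀ K : Set (Eu N × ℝ), IsCompact K → K ⊆ Ω ×ˢ Ioo τ₁ τ₂ →
    IntegrableOn (fun p : Eu N × ℝ => |u p.1 p.2| * ρ p.1) K ∧
      IntegrableOn (fun p : Eu N × ℝ => |u p.1 p.2| ^ m) K
  weak : ∀ ψ : Eu N × ℝ → ℝ, ContDiff ℝ (⊤ : ℕ∞) ψ → HasCompactSupport ψ →
    tsupport ψ ⊆ Ω ×ˢ Ioo τ₁ τ₂ →
    ∫ p in Ω ×ˢ Ioo τ₁ τ₂,
      (u p.1 p.2 * ptder ψ p * ρ p.1 + spow (u p.1 p.2) m * lapX ψ p) = 0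

/-- `u ∈ L^∞_loc(Ω × (τ₁,τ₂))`. -/
def LinftyLoc {N : ℕ} (Ω : Set (Eu N)) (τ₁ τ₂ : ℝ) (u : Eu N → ℝ → ℝ) : Prop :=
  ∀ K : Set (Eu N × ℝ), IsCompact K → K ⊆ Ω ×ˢ Ioo τ₁ τ₂ →
    ∃ M : ℝ, ∀ᵐ p ∂(volume.restrict K : Measure (Eu N × ℝ)), |u p.1 p.2| ≤ M

/-- `λ = (N-γ)/((N-γ)(m-1)+2-γ)`. -/
def lamC (N : ℕ) (γ m : ℝ) : ℝ := ((N:ℝ) - γ) / (((N:ℝ) - γ) * (m - 1) + 2 - γ)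

/-- `θ = (2-γ)/(N-γ)`. -/
def thetC (N : ℕ) (γ : ℝ) : ℝ := (2 - γ) / ((N:ℝ) - γ)

/-- `α(N)`: the Lebesgue measure of the unit ball of `ℝ^N`. -/
def alphaN (N : ℕ) : ℝ := (volume (ball (0 : Eu N) 1)).toReal

/-- The Green function `G(x,y) = (N(N-2)α(N))⁻¹ |x-y|^{2-N}` of `-Δ` on `ℝ^N`, `N ≥ 3`. -/
def GreenFn (N : ℕ) (x y : Eu N) : ℝ :=
  ((N : ℝ) * ((N : ℝ) - 2) * alphaN N)⁻¹ * ‖x - y‖ ^ (2 - (N : ℝ))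

/-- **Weak energy solution** (Definition 3.1) of `ρ u_t = Δ(u^m)` on `ℝ^N × (0,∞)` with
initial datum `u₀ ∈ L¹_ρ(ℝ^N) ∩ L^∞(ℝ^N)`; `g` is the weak spatial gradient of `u^m`,
witnessing `u^m ∈ L²_loc([0,∞); Ḣ¹(ℝ^N))`. -/
structure WES {N : ℕ} (ρ : Eu N → ℝ) (m : ℝ) (u : Eu N → ℝ → ℝ) (u₀ : Eu N → ℝ)
    (g : Eu N → ℝ → Eu N) : Prop where
  u0int : Integrable (fun x : Eu N => |u₀ x| * ρ x)
  u0bdd : ∃ M : ℝ, ∀ᵐ x ∂(volume : Measure (Eu N)), |u₀ x| ≤ M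
  meas : AEMeasurable (fun p : Eu N × ℝ => u p.1 p.2)
    (volume.restrict ((univ : Set (Eu N)) ×ˢ Ioi 0))
  init : ∀ᵐ x ∂(volume : Measure (Eu N)), u x 0 = u₀ x
  int : ∀ t : ℝ, 0 ≤ t → Integrable (fun x : Eu N => |u x t| * ρ x)
  contL1 : ∀ t₀ : ℝ, 0 ≤ t₀ →
    Tendsto (fun t => ∫ x, |u x t - u x t₀| * ρ x) (𝓝[Ici 0] t₀) (𝓝 0)
  bdd : ∃ M : ℝ, ∀ t : ℝ, 0 < t → ∀ᵐ x ∂(volume : Measure (Eu N)), |u x t| ≤ M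
  gradL2 : ∀ S : ℝ, 0 < S →
    IntegrableOn (fun p : Eu N × ℝ => ‖g p.1 p.2‖ ^ 2) ((univ : Set (Eu N)) ×ˢ Ioo 0 S)
  gradProp : ∀ φ : Eu N × ℝ → ℝ, ContDiff ℝ (⊤ : ℕ∞) φ → HasCompactSupport φ →
    tsupport φ ⊆ (univ : Set (Eu N)) ×ˢ Ioi 0 → ∀ i : Fin N,
      ∫ p in (univ : Set (Eu N)) ×ˢ Ioi (0:ℝ),
          spow (u p.1 p.2) m * fderiv ℝ φ p (EuclideanSpace.single i 1, 0) =
        -∫ p in (univ : Set (Eu N)) ×ˢ Ioi (0:ℝ), g p.1 p.2 i * φ p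
  weakEq : ∀ ψ : Eu N × ℝ → ℝ, ContDiff ℝ (⊤ : ℕ∞) ψ → HasCompactSupport ψ →
    tsupport ψ ⊆ (univ : Set (Eu N)) ×ˢ Ioi 0 →
    ∫ p in (univ : Set (Eu N)) ×ˢ Ioi (0:ℝ), u p.1 p.2 * ptder ψ p * ρ p.1 =
      ∫ p in (univ : Set (Eu N)) ×ˢ Ioi (0:ℝ),
        ∑ i : Fin N, g p.1 p.2 i * fderiv ℝ ψ p (EuclideanSpace.single i 1, 0)

/-! ### One-dimensional tools -/

lemma deriv_smoothTransition_nonneg (x : ℝ) : 0 ≤ deriv Real.smoothTransition x :=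
  Real.smoothTransition.monotone.deriv_nonneg

/-- The smooth step rising from `0` at `s` to `1` at `s + ε`. -/
def smoothStep (s ε x : ℝ) : ℝ := Real.smoothTransition ((x - s) / ε)

lemma contDiff_smoothStep (s ε : ℝ) : ContDiff ℝ (⊤ : ℕ∞) (smoothStep s ε) :=
  Real.smoothTransition.contDiff.comp ((contDiff_id.sub contDiff_const).div_const ε)

lemma smoothStep_of_le {s ε x : ℝ} (hε : 0 < ε) (hx : x ≤ s) : smoothStep s ε x = 0 :=
  Real.smoothTransition.zero_of_nonpos (div_nonpos_of_nonpos_of_nonneg (by linarith) hε.le)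

lemma smoothStep_of_ge {s ε x : ℝ} (hε : 0 < ε) (hx : s + ε ≤ x) : smoothStep s ε x = 1 :=
  Real.smoothTransition.one_of_one_le ((one_le_div hε).2 (by linarith))

lemma monotone_smoothStep {s ε : ℝ} (hε : 0 < ε) : Monotone (smoothStep s ε) := fun _ _ h =>
  Real.smoothTransition.monotone (div_le_div_of_nonneg_right (by linarith) hε.le)

lemma deriv_smoothStep_eq_zero {s ε x : ℝ} (hε : 0 < ε) (hx : x ∉ Icc s (s + ε)) :
    deriv (smoothStep s ε) x = 0 := by
  rcases lt_or_ge x s with h | h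
  · have : smoothStep s ε =ᶠ[𝓝 x] fun _ => 0 := by
      filter_upwards [Iio_mem_nhds h] with y hy using smoothStep_of_le hε (le_of_lt hy)
    rw [this.deriv_eq, deriv_const]
  · have h' : s + ε < x := by
      by_contra! h2
      exact hx ⟨h, h2⟩
    have : smoothStep s ε =ᶠ[𝓝 x] fun _ => 1 := by
      filter_upwards [Ioi_mem_nhds h'] with y hy using smoothStep_of_ge hε (le_of_lt hy)
    rw [this.deriv_eq, deriv_const]

lemma continuous_deriv_smoothStep (s ε : ℝ) : Continuous (deriv (smoothStep s ε)) :=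
  (contDiff_smoothStep s ε).continuous_deriv (by norm_cast)

lemma hasDerivAt_smoothStep (s ε x : ℝ) :
    HasDerivAt (smoothStep s ε) (deriv (smoothStep s ε) x) x :=
  ((contDiff_smoothStep s ε).differentiable (by norm_cast) x).hasDerivAt

lemma integrable_mul_deriv_smoothStep {f : ℝ → ℝ} {s ε : ℝ} (hε : 0 < ε)
    (hf : ContinuousOn f (Icc s (s + ε))) :
    Integrable (fun x => f x * deriv (smoothStep s ε) x) := by
  have h : IntegrableOn (fun x => f x * deriv (smoothStep s ε) x) (Icc s (s + ε)) :=
    (hf.mul (continuous_deriv_smoothStep s ε).continuousOn).integrableOn_compact isCompact_Icc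
  refine (integrableOn_iff_integrable_of_support_subset ?_).1 h
  intro x hx
  by_contra hx'
  exact hx (by simp [deriv_smoothStep_eq_zero hε hx'])

lemma integral_deriv_smoothStep {s ε : ℝ} (hε : 0 < ε) :
    ∫ x, deriv (smoothStep s ε) x = 1 := by
  have h := integral_of_hasDerivAt_of_tendsto (f := smoothStep s ε) (m := 0) (n := 1)
    (hasDerivAt_smoothStep s ε)
    (by simpa using integrable_mul_deriv_smoothStep (f := fun _ => 1) hε continuousOn_const)
    (tendsto_const_nhds.congr' (by
      filter_upwards [eventually_le_atBot s] with x hx using (smoothStep_of_le hε hx).symm))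
    (tendsto_const_nhds.congr' (by
      filter_upwards [eventually_ge_atTop (s + ε)] with x hx using (smoothStep_of_ge hε hx).symm))
  simpa using h

/-- A continuous function on an interval whose distributional derivative is non-negative is
non-decreasing. -/
lemma le_of_forall_integral_mul_deriv_nonpos {f : ℝ → ℝ} {a b s t : ℝ}
    (hf : ContinuousOn f (Ioo a b))
    (h : ∀ η : ℝ → ℝ, ContDiff ℝ (⊤ : ℕ∞) η → HasCompactSupport η → tsupport η ⊆ Ioo a b →
      (∀ x, 0 ≤ η x) → ∫ x, f x * deriv η x ≤ 0)
    (hs : a < s) (hst : s ≤ t) (ht : t < b) : f s ≤ f t := by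
  by_contra! hlt
  have hst' : s < t := lt_of_le_of_ne hst (by rintro rfl; exact lt_irrefl _ hlt)
  set c := (f s + f t) / 2 with hc
  set d := (f s - f t) / 4 with hd
  have hd0 : 0 < d := by rw [hd]; linarith
  have cs : ContinuousAt f s := hf.continuousAt (Ioo_mem_nhds hs (hst'.trans ht))
  have ct : ContinuousAt f t := hf.continuousAt (Ioo_mem_nhds (hs.trans hst') ht)
  have es : ∀ᶠ x in 𝓝 s, c + d < f x := cs.eventually_const_lt (by rw [hc, hd]; linarith)
  have et : ∀ᶠ x in 𝓝 t, f x < c - d := ct.eventually_lt_const (by rw [hc, hd]; linarith)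
  obtain ⟨ε₁, hε₁, h₁⟩ := Metric.eventually_nhds_iff.1 es
  obtain ⟨ε₂, hε₂, h₂⟩ := Metric.eventually_nhds_iff.1 et
  obtain ⟨ε, hε, hεlt⟩ : ∃ ε, 0 < ε ∧ ε < min (min ε₁ ε₂) (b - t) :=
    exists_between (lt_min (lt_min hε₁ hε₂) (by linarith))
  have l1 : ε < ε₁ := hεlt.trans_le ((min_le_left _ _).trans (min_le_left _ _))
  have l2 : ε < ε₂ := hεlt.trans_le ((min_le_left _ _).trans (min_le_right _ _))
  have l3 : ε < b - t := hεlt.trans_le (min_le_right _ _)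
  set η : ℝ → ℝ := fun x => smoothStep s ε x - smoothStep t ε x with hη
  have hsupp : Function.support η ⊆ Icc s (t + ε) := by
    intro x hx
    by_contra hx'
    apply hx
    rcases lt_or_ge x s with h | h
    · simp [hη, smoothStep_of_le hε h.le, smoothStep_of_le hε (h.le.trans hst)]
    · have h' : t + ε < x := by
        by_contra! h2
        exact hx' ⟨h, h2⟩
      simp [hη, smoothStep_of_ge hε h'.le, smoothStep_of_ge hε (show s + ε ≤ x by linarith)]
  have hts : tsupport η ⊆ Icc s (t + ε) := closure_minimal hsupp isClosed_Icc
  have hη0 : ∀ x, 0 ≤ η x := fun x => by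
    have : smoothStep t ε x ≤ smoothStep s ε x :=
      Real.smoothTransition.monotone (div_le_div_of_nonneg_right (by linarith) hε.le)
    simpa [hη] using this
  have hI := h η ((contDiff_smoothStep s ε).sub (contDiff_smoothStep t ε))
    (HasCompactSupport.of_support_subset_isCompact isCompact_Icc hsupp)
    (hts.trans (Icc_subset_Ioo hs (by linarith))) hη0
  have hder : ∀ x, deriv η x = deriv (smoothStep s ε) x - deriv (smoothStep t ε) x := fun x =>
    ((hasDerivAt_smoothStep s ε x).sub (hasDerivAt_smoothStep t ε x)).deriv
  have sIcc : Icc s (s + ε) ⊆ Ioo a b := Icc_subset_Ioo hs (by linarith)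
  have tIcc : Icc t (t + ε) ⊆ Ioo a b := Icc_subset_Ioo (by linarith) (by linarith)
  have i1 := integrable_mul_deriv_smoothStep hε (hf.mono sIcc)
  have i2 := integrable_mul_deriv_smoothStep hε (hf.mono tIcc)
  have j1 := integrable_mul_deriv_smoothStep (f := fun _ => c + d) (s := s) hε continuousOn_const
  have j2 := integrable_mul_deriv_smoothStep (f := fun _ => d - c) (s := t) hε continuousOn_const
  have key : ∫ x, ((c + d) * deriv (smoothStep s ε) x + (d - c) * deriv (smoothStep t ε) x) ≤
      ∫ x, f x * deriv η x := by
    refine integral_mono (j1.add j2) ?_ ?_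
    · simp only [hder, mul_sub]
      exact i1.sub i2
    · intro x
      simp only [hder]
      have n1 : 0 ≤ deriv (smoothStep s ε) x := (monotone_smoothStep hε).deriv_nonneg
      have n2 : 0 ≤ deriv (smoothStep t ε) x := (monotone_smoothStep hε).deriv_nonneg
      have p1 : (c + d) * deriv (smoothStep s ε) x ≤ f x * deriv (smoothStep s ε) x := by
        by_cases hx : x ∈ Icc s (s + ε)
        · refine mul_le_mul_of_nonneg_right (h₁ ?_).le n1
          rw [Real.dist_eq, abs_lt]
          constructor <;> linarith [hx.1, hx.2]
        · simp [deriv_smoothStep_eq_zero hε hx]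
      have p2 : f x * deriv (smoothStep t ε) x ≤ (c - d) * deriv (smoothStep t ε) x := by
        by_cases hx : x ∈ Icc t (t + ε)
        · refine mul_le_mul_of_nonneg_right (h₂ ?_).le n2
          rw [Real.dist_eq, abs_lt]
          constructor <;> linarith [hx.1, hx.2]
        · simp [deriv_smoothStep_eq_zero hε hx]
      linarith
  rw [integral_add j1 j2, integral_const_mul, integral_const_mul, integral_deriv_smoothStep hε,
    integral_deriv_smoothStep hε] at key
  linarith

/-- The integral of `(P η)'` vanishes if `P` is differentiable near the compact support of `η`. -/
lemma integral_mul_deriv_add_deriv_mul_eq_zero {P P' η : ℝ → ℝ} {a b : ℝ}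
    (hP : ∀ x ∈ Ioo a b, HasDerivAt P (P' x) x) (hP' : ContinuousOn P' (Ioo a b))
    (hη : ContDiff ℝ (⊤ : ℕ∞) η) (hc : HasCompactSupport η) (hs : tsupport η ⊆ Ioo a b) :
    Integrable (fun x => P x * deriv η x) ∧ Integrable (fun x => P' x * η x) ∧
      ∫ x, P x * deriv η x = -∫ x, P' x * η x := by
  have hPc : ContinuousOn P (Ioo a b) := fun x hx => (hP x hx).continuousAt.continuousWithinAt
  have i1 : Integrable (fun x => P x * deriv η x) := by
    have : IntegrableOn (fun x => P x * deriv η x) (tsupport η) :=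
      ((hPc.mono hs).mul (hη.continuous_deriv
        (by norm_cast)).continuousOn).integrableOn_compact hc
    refine (integrableOn_iff_integrable_of_support_subset ?_).1 this
    exact (Function.support_mul_subset_right _ _).trans
      ((support_deriv_subset (f := η)))
  have i2 : Integrable (fun x => P' x * η x) := by
    have : IntegrableOn (fun x => P' x * η x) (tsupport η) :=
      ((hP'.mono hs).mul hη.continuous.continuousOn).integrableOn_compact hc
    refine (integrableOn_iff_integrable_of_support_subset ?_).1 this
    exact (Function.support_mul_subset_right _ _).trans subset_closure
  have hder : ∀ x, HasDerivAt (fun x => P x * η x) (P' x * η x + P x * deriv η x) x := by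
    intro x
    by_cases hx : x ∈ tsupport η
    · exact (hP x (hs hx)).mul (hη.differentiable (by norm_cast) x).hasDerivAt
    · have h0 : η =ᶠ[𝓝 x] 0 := notMem_tsupport_iff_eventuallyEq.1 hx
      have h1 : (fun x => P x * η x) =ᶠ[𝓝 x] fun _ => 0 := by
        filter_upwards [h0] with y hy
        simp [hy]
      rw [h0.deriv_eq, h0.self_of_nhds]
      simpa using h1.hasDerivAt_iff.2 (hasDerivAt_const x (0 : ℝ))
  have i3 : Integrable (fun x => P x * η x) := by
    have : IntegrableOn (fun x => P x * η x) (tsupport η) :=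
      ((hPc.mono hs).mul hη.continuous.continuousOn).integrableOn_compact hc
    refine (integrableOn_iff_integrable_of_support_subset ?_).1 this
    exact (Function.support_mul_subset_right _ _).trans subset_closure
  have h := integral_eq_zero_of_hasDerivAt_of_integrable hder (i2.add i1) i3
  refine ⟨i1, i2, ?_⟩
  have h2 := integral_add i2 i1
  linarith

/-- A smooth convex function which vanishes on `(-∞, 1]` and has slope at most `1`. -/
def softTrunc (s : ℝ) : ℝ := ∫ r in (0 : ℝ)..s, Real.smoothTransition (r - 1)

lemma hasDerivAt_softTrunc (s : ℝ) :
    HasDerivAt softTrunc (Real.smoothTransition (s - 1)) s :=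
  intervalIntegral.integral_hasDerivAt_right
    ((Real.smoothTransition.continuous.comp (continuous_sub_right 1)).intervalIntegrable _ _)
    (Real.smoothTransition.continuous.comp
      (continuous_sub_right 1)).aestronglyMeasurable.stronglyMeasurableAtFilter
    (Real.smoothTransition.continuous.comp (continuous_sub_right 1)).continuousAt

lemma contDiff_softTrunc : ContDiff ℝ (⊤ : ℕ∞) softTrunc := by
  rw [contDiff_infty_iff_deriv]
  refine ⟨fun x => (hasDerivAt_softTrunc x).differentiableAt, ?_⟩
  rw [show deriv softTrunc = fun s => Real.smoothTransition (s - 1) from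
    funext fun s => (hasDerivAt_softTrunc s).deriv]
  exact Real.smoothTransition.contDiff.comp (contDiff_id.sub contDiff_const)

lemma softTrunc_of_le {s : ℝ} (hs : s ≤ 1) : softTrunc s = 0 := by
  rw [softTrunc, intervalIntegral.integral_congr (g := fun _ => (0 : ℝ)),
    intervalIntegral.integral_zero]
  intro r hr
  refine Real.smoothTransition.zero_of_nonpos ?_
  have := hr.2
  have : max 0 s ≤ 1 := max_le zero_le_one hs
  linarith

lemma softTrunc_nonneg {s : ℝ} (hs : 0 ≤ s) : 0 ≤ softTrunc s :=
  intervalIntegral.integral_nonneg hs fun _ _ => Real.smoothTransition.nonneg _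

lemma softTrunc_le {s : ℝ} (hs : 0 ≤ s) : softTrunc s ≤ s := by
  have := intervalIntegral.integral_mono_on (μ := volume) hs
    ((Real.smoothTransition.continuous.comp (continuous_sub_right 1)).intervalIntegrable _ _)
    (continuous_const.intervalIntegrable 0 s)
    (fun x _ => Real.smoothTransition.le_one (x - 1))
  simpa [softTrunc] using this

lemma sub_two_le_softTrunc {s : ℝ} (hs : 0 ≤ s) : s - 2 ≤ softTrunc s := by
  rcases le_total s 2 with h | h
  · linarith [softTrunc_nonneg hs]
  · have hi : ∀ x y, IntervalIntegrable (fun r => Real.smoothTransition (r - 1)) volume x y :=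
      fun x y => (Real.smoothTransition.continuous.comp
        (continuous_sub_right 1)).intervalIntegrable x y
    have h1 : softTrunc s = softTrunc 2 + ∫ r in (2 : ℝ)..s, Real.smoothTransition (r - 1) :=
      (intervalIntegral.integral_add_adjacent_intervals (hi _ _) (hi _ _)).symm
    have h2 : ∫ r in (2 : ℝ)..s, Real.smoothTransition (r - 1) = ∫ r in (2 : ℝ)..s, (1 : ℝ) := by
      refine intervalIntegral.integral_congr fun r hr => ?_
      rw [uIcc_of_le h] at hr
      exact Real.smoothTransition.one_of_one_le (by linarith [hr.1])
    rw [h1, h2]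
    have := softTrunc_nonneg (s := 2) (by norm_num)
    simp
    linarith

/-! ### The truncated regularised Green function -/

lemma alphaN_pos (N : ℕ) : 0 < alphaN N :=
  ENNReal.toReal_pos (measure_ball_pos _ _ one_pos).ne' measure_ball_lt_top.ne

/-- The Laplacian of a function on `ℝ^N`. -/
def lapS {N : ℕ} (Φ : Eu N → ℝ) (x : Eu N) : ℝ :=
  ∑ i : Fin N, fderiv ℝ (fun y => fderiv ℝ Φ y (EuclideanSpace.single i 1)) x
    (EuclideanSpace.single i 1)

/-- The Laplacian of a radial function, written in terms of the squared radius. -/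
lemma lapS_radial {N : ℕ} {k k₁ k₂ : ℝ → ℝ} (h₁ : ∀ s, 0 ≤ s → HasDerivAt k (k₁ s) s)
    (h₂ : ∀ s, 0 ≤ s → HasDerivAt k₁ (k₂ s) s) (x₀ x : Eu N) :
    lapS (fun y => k (‖y - x₀‖ ^ 2)) x =
      4 * ‖x - x₀‖ ^ 2 * k₂ (‖x - x₀‖ ^ 2) + 2 * N * k₁ (‖x - x₀‖ ^ 2) := by
  have hsq : ∀ y : Eu N, HasFDerivAt (fun y => ‖y - x₀‖ ^ 2) (2 • innerSL ℝ (y - x₀)) y :=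
    fun y => by simpa using (((hasFDerivAt_id y).sub_const x₀).norm_sq)
  have hd : ∀ (i : Fin N) (y : Eu N),
      fderiv ℝ (fun y => k (‖y - x₀‖ ^ 2)) y (EuclideanSpace.single i 1) =
        k₁ (‖y - x₀‖ ^ 2) * (2 * (y i - x₀ i)) := fun i y => by
    have h : HasFDerivAt (fun y => k (‖y - x₀‖ ^ 2)) _ y :=
      (h₁ _ (sq_nonneg ‖y - x₀‖)).comp_hasFDerivAt y (hsq y)
    rw [h.fderiv]
    simp [EuclideanSpace.inner_single_right]
  have hd2 : ∀ i : Fin N,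
      fderiv ℝ (fun y => fderiv ℝ (fun y => k (‖y - x₀‖ ^ 2)) y (EuclideanSpace.single i 1)) x
        (EuclideanSpace.single i 1) =
        4 * k₂ (‖x - x₀‖ ^ 2) * (x i - x₀ i) ^ 2 + 2 * k₁ (‖x - x₀‖ ^ 2) := fun i => by
    have hp : HasFDerivAt (fun y : Eu N => 2 * (y i - x₀ i))
        ((2 : ℝ) • (EuclideanSpace.proj i : Eu N →L[ℝ] ℝ)) x :=
      (((EuclideanSpace.proj i : Eu N →L[ℝ] ℝ).hasFDerivAt).sub_const (x₀ i)).const_mul 2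
    have hk : HasFDerivAt (fun y => k₁ (‖y - x₀‖ ^ 2)) _ x :=
      (h₂ _ (sq_nonneg ‖x - x₀‖)).comp_hasFDerivAt x (hsq x)
    have h : HasFDerivAt (fun y => k₁ (‖y - x₀‖ ^ 2) * (2 * (y i - x₀ i))) _ x := hk.mul hp
    simp only [hd]
    rw [h.fderiv]
    simp [EuclideanSpace.inner_single_right]
    ring
  simp only [lapS, hd2]
  rw [Finset.sum_add_distrib, ← Finset.mul_sum]
  have hn : ‖x - x₀‖ ^ 2 = ∑ i, (x i - x₀ i) ^ 2 := by
    simp [EuclideanSpace.norm_sq_eq]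
  rw [← hn]
  simp
  ring

/-- The regularised Green function, as a function of the squared distance. -/
def greenReg (N : ℕ) (e s : ℝ) : ℝ :=
  ((N : ℝ) * ((N : ℝ) - 2) * alphaN N)⁻¹ * (s + e) ^ (-(((N : ℝ) - 2) / 2))

/-- The mollifier `-Δ` of the regularised Green function, in terms of the squared distance. -/
def greenKer (N : ℕ) (e s : ℝ) : ℝ :=
  (alphaN N)⁻¹ * e * (s + e) ^ (-((N : ℝ) / 2 + 1))

/-- The regularised Green function made compactly supported by a convex truncation. -/
def truncGreen (N : ℕ) (δ e s : ℝ) : ℝ := δ * softTrunc (greenReg N e s / δ)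

lemma contDiffAt_greenReg {N : ℕ} {e s : ℝ} (he : 0 < e) (hs : 0 ≤ s) :
    ContDiffAt ℝ (⊤ : ℕ∞) (greenReg N e) s :=
  contDiffAt_const.mul ((contDiffAt_id.add contDiffAt_const).rpow_const_of_ne
    (by simp only [id]; linarith))

lemma contDiff_truncGreen {N : ℕ} {δ e : ℝ} (he : 0 < e) (x₀ : Eu N) :
    ContDiff ℝ (⊤ : ℕ∞) (fun x => truncGreen N δ e (‖x - x₀‖ ^ 2)) := by
  rw [contDiff_iff_contDiffAt]
  intro x
  have h1 : ContDiffAt ℝ (⊤ : ℕ∞) (fun x : Eu N => ‖x - x₀‖ ^ 2) x :=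
    ((contDiff_id.sub contDiff_const).norm_sq ℝ).contDiffAt
  have h2 := (contDiffAt_greenReg (N := N) he (sq_nonneg ‖x - x₀‖)).comp x h1
  exact contDiffAt_const.mul
    ((contDiff_softTrunc.contDiffAt).comp x (h2.div_const δ))

section

variable {N : ℕ} (hN : 3 ≤ N) {δ e : ℝ} (hδ : 0 < δ) (he : 0 < e)

include hN

lemma greenConst_pos : 0 < ((N : ℝ) * ((N : ℝ) - 2) * alphaN N)⁻¹ := by
  have : (3 : ℝ) ≤ N := by exact_mod_cast hN
  have := alphaN_pos N
  have h2 : 0 < (N : ℝ) - 2 := by linarith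
  positivity

lemma hasCompactSupport_truncGreen {δ : ℝ} (hδ : 0 < δ) (e : ℝ) (x₀ : Eu N) :
    HasCompactSupport (fun x => truncGreen N δ e (‖x - x₀‖ ^ 2)) := by
  have h3 : (3 : ℝ) ≤ N := by exact_mod_cast hN
  have hlim : Tendsto (greenReg N e) atTop (𝓝 0) := by
    have h1 : Tendsto (fun s : ℝ => (s + e) ^ (-(((N : ℝ) - 2) / 2))) atTop (𝓝 0) :=
      (tendsto_rpow_neg_atTop (by linarith)).comp (tendsto_atTop_add_const_right _ e tendsto_id)
    have h2 := h1.const_mul ((N : ℝ) * ((N : ℝ) - 2) * alphaN N)⁻¹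
    rw [mul_zero] at h2
    exact h2
  obtain ⟨R, hR⟩ := eventually_atTop.1 (hlim.eventually_le_const hδ)
  refine HasCompactSupport.of_support_subset_isCompact (isCompact_closedBall x₀ (max R 1)) ?_
  intro x hx
  by_contra hx'
  apply hx
  rw [mem_closedBall, dist_eq_norm, not_le] at hx'
  have h1 : 1 < ‖x - x₀‖ := (le_max_right _ _).trans_lt hx'
  have h2 : R < ‖x - x₀‖ := (le_max_left _ _).trans_lt hx'
  have := hR (‖x - x₀‖ ^ 2) (by nlinarith)
  simp only [truncGreen]
  rw [softTrunc_of_le ((div_le_one hδ).2 this), mul_zero]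

include he

lemma greenReg_pos {s : ℝ} (hs : 0 ≤ s) : 0 < greenReg N e s :=
  mul_pos (greenConst_pos hN) (Real.rpow_pos_of_pos (by linarith) _)

lemma greenReg_le_green {x x₀ : Eu N} (hx : x ≠ x₀) :
    greenReg N e (‖x - x₀‖ ^ 2) ≤ GreenFn N x x₀ := by
  have h3 : (3 : ℝ) ≤ N := by exact_mod_cast hN
  have hp : 0 < ‖x - x₀‖ := norm_pos_iff.2 (sub_ne_zero.2 hx)
  refine mul_le_mul_of_nonneg_left ?_ (greenConst_pos hN).le
  calc (‖x - x₀‖ ^ 2 + e) ^ (-(((N : ℝ) - 2) / 2))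
      ≤ (‖x - x₀‖ ^ 2) ^ (-(((N : ℝ) - 2) / 2)) :=
        Real.rpow_le_rpow_of_nonpos (by positivity) (by linarith) (by linarith)
    _ = ‖x - x₀‖ ^ (2 - (N : ℝ)) := by
        rw [← Real.rpow_natCast, ← Real.rpow_mul hp.le]
        congr 1
        push_cast
        ring

include hδ

lemma truncGreen_nonneg {s : ℝ} (hs : 0 ≤ s) : 0 ≤ truncGreen N δ e s :=
  mul_nonneg hδ.le (softTrunc_nonneg (div_nonneg (greenReg_pos hN he hs).le hδ.le))

lemma truncGreen_le {s : ℝ} (hs : 0 ≤ s) : truncGreen N δ e s ≤ greenReg N e s := by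
  have := softTrunc_le (div_nonneg (greenReg_pos hN he hs).le hδ.le)
  calc truncGreen N δ e s ≤ δ * (greenReg N e s / δ) := mul_le_mul_of_nonneg_left this hδ.le
    _ = _ := by field_simp

lemma greenReg_sub_le_truncGreen {s : ℝ} (hs : 0 ≤ s) :
    greenReg N e s - 2 * δ ≤ truncGreen N δ e s := by
  have := sub_two_le_softTrunc (div_nonneg (greenReg_pos hN he hs).le hδ.le)
  calc greenReg N e s - 2 * δ = δ * (greenReg N e s / δ - 2) := by field_simp
    _ ≤ _ := mul_le_mul_of_nonneg_left this hδ.le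

lemma neg_lapS_truncGreen_le (x₀ x : Eu N) :
    -lapS (fun y => truncGreen N δ e (‖y - x₀‖ ^ 2)) x ≤ greenKer N e (‖x - x₀‖ ^ 2) := by
  have h3 : (3 : ℝ) ≤ N := by exact_mod_cast hN
  have hα := alphaN_pos N
  set c : ℝ := ((N : ℝ) * ((N : ℝ) - 2) * alphaN N)⁻¹ with hc
  have hc0 : 0 < c := greenConst_pos hN
  set q : ℝ := ((N : ℝ) - 2) / 2 with hq
  set g₁ : ℝ → ℝ := fun s => c * (-q * (s + e) ^ (-q - 1)) with hg₁
  set g₂ : ℝ → ℝ := fun s => c * (-q * ((-q - 1) * (s + e) ^ (-q - 1 - 1))) with hg₂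
  have d0 : ∀ s, 0 ≤ s → ∀ r : ℝ, HasDerivAt (fun s => (s + e) ^ r) (r * (s + e) ^ (r - 1)) s := by
    intro s hs r
    have := ((hasDerivAt_id s).add_const e).rpow_const (p := r) (Or.inl (by simp; linarith))
    simpa using this
  have dg : ∀ s, 0 ≤ s → HasDerivAt (greenReg N e) (g₁ s) s := fun s hs =>
    (d0 s hs (-q)).const_mul c
  have dg₁ : ∀ s, 0 ≤ s → HasDerivAt g₁ (g₂ s) s := fun s hs =>
    ((d0 s hs (-q - 1)).const_mul (-q)).const_mul c
  set T : ℝ → ℝ := fun s => Real.smoothTransition (greenReg N e s / δ - 1) with hT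
  set S : ℝ → ℝ := fun s => deriv Real.smoothTransition (greenReg N e s / δ - 1) with hS
  have dT : ∀ s, 0 ≤ s → HasDerivAt T (S s * (g₁ s / δ)) s := fun s hs =>
    HasDerivAt.comp s ((Real.smoothTransition.contDiff (n := (⊤ : ℕ∞))).differentiable
      (by norm_cast) _).hasDerivAt (((dg s hs).div_const δ).sub_const 1)
  have dk : ∀ s, 0 ≤ s → HasDerivAt (truncGreen N δ e) (T s * g₁ s) s := fun s hs => by
    have := ((hasDerivAt_softTrunc (greenReg N e s / δ)).comp s ((dg s hs).div_const δ)).const_mul δ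
    have h : δ * (Real.smoothTransition (greenReg N e s / δ - 1) * (g₁ s / δ)) = T s * g₁ s := by
      simp only [hT]
      field_simp
    rw [h] at this
    exact this
  have dk₁ : ∀ s, 0 ≤ s →
      HasDerivAt (fun s => T s * g₁ s) (S s * (g₁ s / δ) * g₁ s + T s * g₂ s) s := fun s hs =>
    (dT s hs).mul (dg₁ s hs)
  rw [lapS_radial dk dk₁]
  set s : ℝ := ‖x - x₀‖ ^ 2 with hs
  have hs0 : 0 ≤ s := sq_nonneg _
  have hse : 0 < s + e := by linarith
  have hS0 : 0 ≤ S s := deriv_smoothTransition_nonneg _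
  have hT0 : 0 ≤ T s := Real.smoothTransition.nonneg _
  have hT1 : T s ≤ 1 := Real.smoothTransition.le_one _
  have key : -(4 * s * g₂ s + 2 * N * g₁ s) = greenKer N e s := by
    have e1 : (s + e) ^ (-q - 1) = (s + e) * (s + e) ^ (-((N : ℝ) / 2 + 1)) := by
      rw [show -q - 1 = 1 + (-((N : ℝ) / 2 + 1)) by rw [hq]; ring, Real.rpow_add hse,
        Real.rpow_one]
    have e2 : (s + e) ^ (-q - 1 - 1) = (s + e) ^ (-((N : ℝ) / 2 + 1)) := by
      congr 1
      rw [hq]; ring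
    have e3 : c * (N * (2 * q)) = (alphaN N)⁻¹ := by
      have h2 : (N : ℝ) - 2 ≠ 0 := by intro h; linarith
      have h4 : (N : ℝ) ≠ 0 := by intro h; linarith
      rw [hc, hq]
      field_simp
    simp only [hg₁, hg₂, greenKer, e1, e2, ← e3]
    rw [show (N : ℝ) = 2 * q + 2 by rw [hq]; ring]
    ring
  have hker : 0 ≤ greenKer N e s := by
    rw [greenKer]
    have := Real.rpow_pos_of_pos hse (-((N : ℝ) / 2 + 1))
    positivity
  have hsq : 0 ≤ 4 * s * (S s * (g₁ s / δ) * g₁ s) := by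
    rw [show 4 * s * (S s * (g₁ s / δ) * g₁ s) = 4 * s * (S s * (g₁ s ^ 2 / δ)) by ring]
    positivity
  calc -(4 * s * (S s * (g₁ s / δ) * g₁ s + T s * g₂ s) + 2 * N * (T s * g₁ s))
      = T s * greenKer N e s - 4 * s * (S s * (g₁ s / δ) * g₁ s) := by rw [← key]; ring
    _ ≤ T s * greenKer N e s := by linarith
    _ ≤ greenKer N e s := mul_le_of_le_one_left hker hT1

end

lemma tendsto_truncGreen {N : ℕ} (hN : 3 ≤ N) {e : ℕ → ℝ} (he : ∀ n, 0 < e n)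
    (he0 : Tendsto e atTop (𝓝 0)) {x x₀ : Eu N} (hx : x ≠ x₀) :
    Tendsto (fun n => truncGreen N (e n) (e n) (‖x - x₀‖ ^ 2)) atTop (𝓝 (GreenFn N x x₀)) := by
  have hp : 0 < ‖x - x₀‖ := norm_pos_iff.2 (sub_ne_zero.2 hx)
  have h1 : Tendsto (fun n => greenReg N (e n) (‖x - x₀‖ ^ 2)) atTop (𝓝 (GreenFn N x x₀)) := by
    have h2 : Tendsto (fun n => ‖x - x₀‖ ^ 2 + e n) atTop (𝓝 (‖x - x₀‖ ^ 2 + 0)) :=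
      tendsto_const_nhds.add he0
    rw [add_zero] at h2
    have h3 := (h2.rpow_const (p := -(((N : ℝ) - 2) / 2)) (Or.inl (by positivity))).const_mul
      ((N : ℝ) * ((N : ℝ) - 2) * alphaN N)⁻¹
    have h4 : (‖x - x₀‖ ^ 2) ^ (-(((N : ℝ) - 2) / 2)) = ‖x - x₀‖ ^ (2 - (N : ℝ)) := by
      rw [← Real.rpow_natCast, ← Real.rpow_mul hp.le]
      congr 1
      push_cast
      ring
    rw [h4] at h3
    exact h3
  have h2 : Tendsto (fun n => greenReg N (e n) (‖x - x₀‖ ^ 2) - 2 * e n) atTop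
      (𝓝 (GreenFn N x x₀)) := by
    simpa using h1.sub (he0.const_mul 2)
  exact tendsto_of_tendsto_of_tendsto_of_le_of_le h2 h1
    (fun n => greenReg_sub_le_truncGreen hN (he n) (he n) (sq_nonneg _))
    (fun n => truncGreen_le hN (he n) (he n) (sq_nonneg _))

/-! ### The mollifier `greenKer` is an approximate identity -/

lemma integrable_prod_of_slice_bound {α β : Type*} [MeasurableSpace α] [MeasurableSpace β]
    {μ : Measure α} {ν : Measure β} [SFinite μ] [SFinite ν] {h : α × β → ℝ} {B : β → ℝ}
    (hm : AEStronglyMeasurable h (μ.prod ν)) (hB : Integrable B ν)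
    (h₁ : ∀ᵐ t ∂ν, Integrable (fun x => h (x, t)) μ)
    (h₂ : ∀ᵐ t ∂ν, ∫ x, ‖h (x, t)‖ ∂μ ≤ B t) : Integrable h (μ.prod ν) := by
  refine (integrable_prod_iff' hm).2 ⟨h₁, hB.mono' hm.norm.prod_swap.integral_prod_right' ?_⟩
  filter_upwards [h₂] with t ht
  rw [Real.norm_of_nonneg (integral_nonneg fun _ => norm_nonneg _)]
  exact ht

/-- The density with which indicators of balls are superposed to give `greenKer N 1`. -/
def greenLayer (N : ℕ) (s : ℝ) : ℝ :=
  (alphaN N)⁻¹ * (((N : ℝ) + 2) * s * (1 + s ^ 2) ^ (-((N : ℝ) / 2 + 2)))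

lemma greenLayer_nonneg (N : ℕ) {s : ℝ} (hs : 0 ≤ s) : 0 ≤ greenLayer N s := by
  have := alphaN_pos N
  rw [greenLayer]
  positivity

lemma hasDerivAt_one_add_sq_rpow (r s : ℝ) :
    HasDerivAt (fun s : ℝ => (1 + s ^ 2) ^ r) (2 * s * r * (1 + s ^ 2) ^ (r - 1)) s := by
  have h : HasDerivAt (fun s : ℝ => 1 + s ^ 2) (2 * s) s := by
    simpa using (hasDerivAt_pow 2 s).const_add 1
  exact h.rpow_const (Or.inl (by positivity))

lemma greenLayer_tail (N : ℕ) {a : ℝ} (ha : 0 ≤ a) :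
    ∫ s in Ioi a, greenLayer N s = (alphaN N)⁻¹ * (1 + a ^ 2) ^ (-((N : ℝ) / 2 + 1)) := by
  have hd : ∀ s ∈ Ici a, HasDerivAt
      (fun s : ℝ => -((alphaN N)⁻¹ * (1 + s ^ 2) ^ (-((N : ℝ) / 2 + 1)))) (greenLayer N s) s := by
    intro s _
    have h := ((hasDerivAt_one_add_sq_rpow (-((N : ℝ) / 2 + 1)) s).const_mul (alphaN N)⁻¹).neg
    refine h.congr_deriv ?_
    rw [greenLayer, show -((N : ℝ) / 2 + 1) - 1 = -((N : ℝ) / 2 + 2) by ring]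
    ring
  have hlim : Tendsto (fun s : ℝ => -((alphaN N)⁻¹ * (1 + s ^ 2) ^ (-((N : ℝ) / 2 + 1)))) atTop
      (𝓝 0) := by
    have h1 : Tendsto (fun s : ℝ => 1 + s ^ 2) atTop atTop :=
      tendsto_atTop_add_const_left _ _ (tendsto_pow_atTop two_ne_zero)
    have h2 := (((tendsto_rpow_neg_atTop (show 0 < (N : ℝ) / 2 + 1 by positivity)).comp
      h1).const_mul (alphaN N)⁻¹).neg
    rw [mul_zero, neg_zero] at h2
    exact h2
  rw [integral_Ioi_of_hasDerivAt_of_nonneg' hd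
    (fun s hs => greenLayer_nonneg N (ha.trans (le_of_lt hs))) hlim]
  ring

lemma greenLayer_mass (N : ℕ) :
    IntegrableOn (fun s => greenLayer N s * (alphaN N * s ^ N)) (Ioi 0) ∧
      ∫ s in Ioi (0 : ℝ), greenLayer N s * (alphaN N * s ^ N) = 1 := by
  have hα := alphaN_pos N
  have hd : ∀ s ∈ Ici (0 : ℝ), HasDerivAt
      (fun s : ℝ => s ^ (N + 2) * (1 + s ^ 2) ^ (-((N : ℝ) / 2 + 1)))
      (greenLayer N s * (alphaN N * s ^ N)) s := by
    intro s _
    have h := (hasDerivAt_pow (N + 2) s).mul (hasDerivAt_one_add_sq_rpow (-((N : ℝ) / 2 + 1)) s)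
    refine h.congr_deriv ?_
    have e1 : (1 + s ^ 2 : ℝ) ^ (-((N : ℝ) / 2 + 1)) =
        (1 + s ^ 2) * (1 + s ^ 2) ^ (-((N : ℝ) / 2 + 2)) := by
      rw [show -((N : ℝ) / 2 + 1) = 1 + (-((N : ℝ) / 2 + 2)) by ring,
        Real.rpow_add (by positivity), Real.rpow_one]
    rw [greenLayer, e1, show -((N : ℝ) / 2 + 1) - 1 = -((N : ℝ) / 2 + 2) by ring]
    push_cast
    field_simp
    ring
  have hlim : Tendsto (fun s : ℝ => s ^ (N + 2) * (1 + s ^ 2) ^ (-((N : ℝ) / 2 + 1))) atTop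
      (𝓝 1) := by
    have h1 : Tendsto (fun s : ℝ => 1 + s ^ 2) atTop atTop :=
      tendsto_atTop_add_const_left _ _ (tendsto_pow_atTop two_ne_zero)
    have h2 : Tendsto (fun s : ℝ => (1 - (1 + s ^ 2)⁻¹) ^ ((N : ℝ) / 2 + 1)) atTop (𝓝 1) := by
      have h3 : Tendsto (fun s : ℝ => 1 - (1 + s ^ 2)⁻¹) atTop (𝓝 (1 - 0)) :=
        tendsto_const_nhds.sub (tendsto_inv_atTop_zero.comp h1)
      rw [sub_zero] at h3
      simpa using h3.rpow_const (p := (N : ℝ) / 2 + 1) (Or.inl one_ne_zero)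
    refine h2.congr' ?_
    filter_upwards [eventually_gt_atTop 0] with s hs
    have hq : 1 - (1 + s ^ 2)⁻¹ = s ^ 2 / (1 + s ^ 2) := by
      field_simp
      ring
    rw [hq, Real.div_rpow (by positivity) (by positivity), Real.rpow_neg (by positivity),
      div_eq_mul_inv]
    congr 1
    rw [← Real.rpow_natCast s 2, ← Real.rpow_mul hs.le, ← Real.rpow_natCast s (N + 2)]
    congr 1
    push_cast
    ring
  have hpos : ∀ s ∈ Ioi (0 : ℝ), 0 ≤ greenLayer N s * (alphaN N * s ^ N) := fun s hs =>
    mul_nonneg (greenLayer_nonneg N (le_of_lt hs)) (mul_nonneg hα.le (pow_nonneg (le_of_lt hs) _))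
  refine ⟨integrableOn_Ioi_deriv_of_nonneg' hd hpos hlim, ?_⟩
  rw [integral_Ioi_of_hasDerivAt_of_nonneg' hd hpos hlim]
  simp

lemma greenKer_sq {N : ℕ} {h r : ℝ} (hh : 0 < h) :
    greenKer N (h ^ 2) (r ^ 2) =
      (h ^ N)⁻¹ * ((alphaN N)⁻¹ * (1 + (r / h) ^ 2) ^ (-((N : ℝ) / 2 + 1))) := by
  have e1 : r ^ 2 + h ^ 2 = h ^ 2 * (1 + (r / h) ^ 2) := by
    field_simp
    ring
  have e2 : (h ^ 2) ^ (-((N : ℝ) / 2 + 1)) = (h ^ (N + 2))⁻¹ := by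
    rw [← Real.rpow_natCast h 2, ← Real.rpow_mul hh.le, ← Real.rpow_natCast h (N + 2),
      ← Real.rpow_neg hh.le]
    congr 1
    push_cast
    ring
  rw [greenKer, e1, Real.mul_rpow (by positivity) (by positivity), e2, pow_add]
  field_simp

lemma alphaN_closedBall {N : ℕ} (x₀ : Eu N) {r : ℝ} (hr : 0 ≤ r) :
    volume.real (closedBall x₀ r) = alphaN N * r ^ N := by
  rw [Measure.addHaar_real_closedBall _ _ hr]
  simp [alphaN, Measure.real, mul_comm]

/-- The integrand of the layer-cake representation of `greenKer`. -/
def layerCake {N : ℕ} (f : Eu N → ℝ) (x₀ : Eu N) (h : ℝ) (p : Eu N × ℝ) : ℝ :=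
  {p : Eu N × ℝ | ‖p.1 - x₀‖ ≤ h * p.2}.indicator
    (fun p => (h ^ N)⁻¹ * greenLayer N p.2 * f p.1) p

lemma continuous_greenLayer (N : ℕ) : Continuous (greenLayer N) := by
  unfold greenLayer
  refine continuous_const.mul ((continuous_const.mul continuous_id).mul ?_)
  exact (continuous_const.add (continuous_id.pow 2)).rpow_const fun s => Or.inl (by
    change 1 + s ^ 2 ≠ 0; positivity)

lemma layerCake_slice {N : ℕ} (f : Eu N → ℝ) (x₀ : Eu N) (h s : ℝ) :
    (fun x => layerCake f x₀ h (x, s)) =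
      (closedBall x₀ (h * s)).indicator (fun x => (h ^ N)⁻¹ * greenLayer N s * f x) := by
  ext x
  simp [layerCake, indicator, dist_eq_norm]

lemma integrable_layerCake {N : ℕ} {f : Eu N → ℝ} {M : ℝ} (hf : AEStronglyMeasurable f volume)
    (hM : ∀ᵐ x, |f x| ≤ M) (x₀ : Eu N) {h : ℝ} (hh : 0 < h) :
    Integrable (layerCake f x₀ h) (volume.prod (volume.restrict (Ioi 0))) := by
  have hloc : ∀ r, IntegrableOn f (closedBall x₀ r) := fun r =>
    Measure.integrableOn_of_bounded measure_closedBall_lt_top.ne hf (ae_restrict_of_ae hM)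
  have hset : MeasurableSet {p : Eu N × ℝ | ‖p.1 - x₀‖ ≤ h * p.2} :=
    measurableSet_le ((measurable_fst.sub_const x₀).norm) (measurable_snd.const_mul h)
  refine integrable_prod_of_slice_bound
    (B := fun s => M * (greenLayer N s * (alphaN N * s ^ N))) ?_
    ((greenLayer_mass N).1.const_mul M) ?_ ?_
  · refine AEStronglyMeasurable.indicator ?_ hset
    exact (aestronglyMeasurable_const.mul ((continuous_greenLayer N).comp
      continuous_snd).aestronglyMeasurable).mul hf.comp_fst
  · refine Eventually.of_forall fun s => ?_
    rw [layerCake_slice]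
    exact IntegrableOn.integrable_indicator ((hloc _).const_mul _) measurableSet_closedBall
  · filter_upwards [ae_restrict_mem measurableSet_Ioi] with s hs
    have hs0 : 0 < s := hs
    have e : ∀ x, ‖layerCake f x₀ h (x, s)‖ = (closedBall x₀ (h * s)).indicator
        (fun x => (h ^ N)⁻¹ * greenLayer N s * |f x|) x := fun x => by
      rw [show layerCake f x₀ h (x, s) = _ from congrFun (layerCake_slice f x₀ h s) x,
        norm_indicator_eq_indicator_norm]
      simp only [indicator, norm_mul, Real.norm_eq_abs,
        abs_of_nonneg (greenLayer_nonneg N hs0.le), abs_of_pos (inv_pos.2 (pow_pos hh N))]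
    simp only [e]
    rw [integral_indicator measurableSet_closedBall, integral_const_mul]
    have hb : ∫ x in closedBall x₀ (h * s), |f x| ≤ M * (alphaN N * (h * s) ^ N) := by
      rw [← alphaN_closedBall x₀ (by positivity)]
      have hn := norm_setIntegral_le_of_norm_le_const_ae (μ := volume) (f := fun x => |f x|)
        (C := M) (s := closedBall x₀ (h * s)) measure_closedBall_lt_top
        (ae_restrict_of_ae (hM.mono fun x hx => by simpa using hx))
      exact (le_abs_self _).trans hn
    calc (h ^ N)⁻¹ * greenLayer N s * ∫ x in closedBall x₀ (h * s), |f x|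
        ≤ (h ^ N)⁻¹ * greenLayer N s * (M * (alphaN N * (h * s) ^ N)) :=
          mul_le_mul_of_nonneg_left hb (mul_nonneg (by positivity) (greenLayer_nonneg N hs0.le))
      _ = _ := by
          rw [mul_pow]
          field_simp

lemma integral_layerCake_snd {N : ℕ} (f : Eu N → ℝ) (x₀ x : Eu N) {h : ℝ} (hh : 0 < h) :
    ∫ s in Ioi (0 : ℝ), layerCake f x₀ h (x, s) = f x * greenKer N (h ^ 2) (‖x - x₀‖ ^ 2) := by
  have e : ∀ s, layerCake f x₀ h (x, s) =
      (Ici (‖x - x₀‖ / h)).indicator (fun s => (h ^ N)⁻¹ * f x * greenLayer N s) s := fun s => by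
    simp only [layerCake, indicator, mem_ofPred_eq, mem_Ici, div_le_iff₀ hh, mul_comm s h]
    split_ifs <;> ring
  simp only [e]
  have ha : 0 ≤ ‖x - x₀‖ / h := by positivity
  rw [integral_indicator measurableSet_Ici, Measure.restrict_restrict measurableSet_Ici,
    integral_const_mul]
  have hae : (Ici (‖x - x₀‖ / h) ∩ Ioi 0 : Set ℝ) =ᵐ[volume] Ioi (‖x - x₀‖ / h) := by
    have h1 : Ioi (‖x - x₀‖ / h) = (Ioi (‖x - x₀‖ / h) ∩ Ioi 0 : Set ℝ) := by
      exact (inter_eq_left.2 (Ioi_subset_Ioi ha)).symm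
    rw [h1]
    exact Ioi_ae_eq_Ici.symm.inter (ae_eq_refl _)
  rw [setIntegral_congr_set hae, greenLayer_tail N ha, greenKer_sq hh]
  ring

lemma integrable_mul_greenKer {N : ℕ} {f : Eu N → ℝ} {M : ℝ}
    (hf : AEStronglyMeasurable f volume) (hM : ∀ᵐ x, |f x| ≤ M) (x₀ : Eu N) {h : ℝ} (hh : 0 < h) :
    Integrable (fun x => f x * greenKer N (h ^ 2) (‖x - x₀‖ ^ 2)) := by
  have := (integrable_layerCake hf hM x₀ hh).integral_prod_left
  simpa only [integral_layerCake_snd _ _ _ hh] using this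

lemma integral_mul_greenKer {N : ℕ} {f : Eu N → ℝ} {M : ℝ}
    (hf : AEStronglyMeasurable f volume) (hM : ∀ᵐ x, |f x| ≤ M) (x₀ : Eu N) {h : ℝ} (hh : 0 < h) :
    ∫ x, f x * greenKer N (h ^ 2) (‖x - x₀‖ ^ 2) =
      ∫ s in Ioi (0 : ℝ), greenLayer N s * (alphaN N * s ^ N) *
        ⨍ x in closedBall x₀ (h * s), f x := by
  have hi := integrable_layerCake hf hM x₀ hh
  have h1 := integral_prod _ hi
  rw [integral_prod_symm _ hi] at h1
  simp only [integral_layerCake_snd _ _ _ hh] at h1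
  rw [← h1]
  refine setIntegral_congr_fun measurableSet_Ioi fun s hs => ?_
  have hs0 : 0 < s := hs
  have hα := alphaN_pos N
  simp only [layerCake_slice]
  rw [integral_indicator measurableSet_closedBall, integral_const_mul, setAverage_eq,
    alphaN_closedBall x₀ (by positivity), mul_pow, smul_eq_mul]
  field_simp

/-- Convolutions with `greenKer` converge at Lebesgue points. -/
lemma ae_tendsto_integral_mul_greenKer {N : ℕ} {f : Eu N → ℝ} {M : ℝ}
    (hf : AEStronglyMeasurable f volume) (hM : ∀ᵐ x, |f x| ≤ M) {h : ℕ → ℝ} (hh : ∀ n, 0 < h n)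
    (hh0 : Tendsto h atTop (𝓝 0)) :
    ∀ᵐ x₀ : Eu N, Tendsto (fun n => ∫ x, f x * greenKer N ((h n) ^ 2) (‖x - x₀‖ ^ 2)) atTop
      (𝓝 (f x₀)) := by
  have hloc : LocallyIntegrable f volume := fun x =>
    ⟨closedBall x 1, closedBall_mem_nhds x one_pos,
      Measure.integrableOn_of_bounded measure_closedBall_lt_top.ne hf (ae_restrict_of_ae hM)⟩
  filter_upwards [IsUnifLocDoublingMeasure.ae_tendsto_average volume hloc 1] with x₀ hx₀
  simp only [integral_mul_greenKer hf hM x₀ (hh _)]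
  obtain ⟨hi, hone⟩ := greenLayer_mass N
  have hlim : f x₀ = ∫ s in Ioi (0 : ℝ), greenLayer N s * (alphaN N * s ^ N) * f x₀ := by
    rw [integral_mul_const, hone, one_mul]
  rw [hlim]
  refine tendsto_integral_of_dominated_convergence
    (fun s => greenLayer N s * (alphaN N * s ^ N) * M) (fun n => ?_) (hi.mul_const M)
    (fun n => ?_) ?_
  · have h1 := (integrable_layerCake hf hM x₀ (hh n)).integral_prod_right.aestronglyMeasurable
    refine h1.congr ?_
    filter_upwards [ae_restrict_mem measurableSet_Ioi] with s hs
    have hs0 : 0 < s := hs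
    have hα := alphaN_pos N
    have hn := hh n
    simp only [layerCake_slice]
    rw [integral_indicator measurableSet_closedBall, integral_const_mul, setAverage_eq,
      alphaN_closedBall x₀ (by positivity), mul_pow, smul_eq_mul]
    field_simp
  · filter_upwards [ae_restrict_mem measurableSet_Ioi] with s hs
    have hs0 : 0 < s := hs
    have hα := alphaN_pos N
    have hn := hh n
    have hk := greenLayer_nonneg N hs0.le
    rw [norm_mul, Real.norm_of_nonneg (by positivity)]
    refine mul_le_mul_of_nonneg_left ?_ (by positivity)
    have hv : 0 < volume.real (closedBall x₀ (h n * s)) := by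
      rw [alphaN_closedBall x₀ (by positivity)]
      positivity
    rw [setAverage_eq, norm_smul, norm_inv, Real.norm_of_nonneg hv.le, inv_mul_le_iff₀ hv,
      mul_comm _ M]
    exact norm_setIntegral_le_of_norm_le_const_ae (μ := volume) (f := f) (C := M)
      (s := closedBall x₀ (h n * s)) measure_closedBall_lt_top
      (ae_restrict_of_ae (hM.mono fun x hx => by simpa using hx))
  · filter_upwards [ae_restrict_mem measurableSet_Ioi] with s hs
    have hs0 : 0 < s := hs
    refine (hx₀ (fun _ => x₀) (fun n => h n * s) ?_ ?_).const_mul _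
    · refine tendsto_nhdsWithin_iff.2 ⟨by simpa using hh0.mul_const s, ?_⟩
      exact Eventually.of_forall fun n => mul_pos (hh n) hs0
    · refine Eventually.of_forall fun n => mem_closedBall_self ?_
      have := hh n
      positivity

/-- The space-time domain `ℝ^N × (0,∞)` carries a product measure. -/
lemma restrict_univ_prod_Ioi (N : ℕ) :
    (volume : Measure (Eu N × ℝ)).restrict ((univ : Set (Eu N)) ×ˢ Ioi 0) =
      (volume : Measure (Eu N)).prod (volume.restrict (Ioi 0)) := by
  rw [Measure.volume_eq_prod, ← Measure.prod_restrict, Measure.restrict_univ]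

/-- The properties of a bounded non-negative mass-preserving solution that do not involve the
equation. -/
structure WeightedFlow {N : ℕ} (ρ : Eu N → ℝ) (u : Eu N → ℝ → ℝ) (A M : ℝ) : Prop where
  measurable_weight : Measurable ρ
  weight_pos : ∀ᵐ x, 0 < ρ x
  aesm : AEStronglyMeasurable (fun p : Eu N × ℝ => u p.1 p.2)
    ((volume : Measure (Eu N)).prod (volume.restrict (Ioi 0)))
  aesm_slice : ∀ t, 0 < t → AEStronglyMeasurable (fun x => u x t) volume
  nonneg : ∀ t, 0 < t → ∀ᵐ x, 0 ≤ u x t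
  bdd : ∀ t, 0 < t → ∀ᵐ x, |u x t| ≤ M
  int : ∀ t, 0 < t → Integrable (fun x => u x t * ρ x)
  mass : ∀ t, 0 < t → ∫ x, u x t * ρ x = A
  cont : ∀ t₀, 0 < t₀ → Tendsto (fun t => ∫ x, |u x t - u x t₀| * ρ x) (𝓝 t₀) (𝓝 0)

section ProductTest

variable {N : ℕ} {Φ : Eu N → ℝ} {ζ : ℝ → ℝ}

lemma contDiff_mul_snd (hΦ : ContDiff ℝ (⊤ : ℕ∞) Φ) (hζ : ContDiff ℝ (⊤ : ℕ∞) ζ) :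
    ContDiff ℝ (⊤ : ℕ∞) (fun p : Eu N × ℝ => Φ p.1 * ζ p.2) :=
  (hΦ.comp contDiff_fst).mul (hζ.comp contDiff_snd)

lemma tsupport_mul_snd_subset :
    tsupport (fun p : Eu N × ℝ => Φ p.1 * ζ p.2) ⊆ tsupport Φ ×ˢ tsupport ζ := by
  refine closure_minimal (fun p hp => ?_) ((isClosed_tsupport Φ).prod (isClosed_tsupport ζ))
  rw [Function.mem_support] at hp
  exact ⟨subset_tsupport Φ (left_ne_zero_of_mul hp), subset_tsupport ζ (right_ne_zero_of_mul hp)⟩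

lemma hasCompactSupport_mul_snd (hΦ : HasCompactSupport Φ) (hζ : HasCompactSupport ζ) :
    HasCompactSupport (fun p : Eu N × ℝ => Φ p.1 * ζ p.2) :=
  IsCompact.of_isClosed_subset (hΦ.isCompact.prod hζ.isCompact) (isClosed_tsupport _)
    tsupport_mul_snd_subset

lemma tsupport_mul_snd_subset_univ_prod {T : Set ℝ} (hζ : tsupport ζ ⊆ T) :
    tsupport (fun p : Eu N × ℝ => Φ p.1 * ζ p.2) ⊆ (univ : Set (Eu N)) ×ˢ T :=
  tsupport_mul_snd_subset.trans (prod_mono (subset_univ _) hζ)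

lemma fderiv_mul_snd (p : Eu N × ℝ) (hΦ : DifferentiableAt ℝ Φ p.1)
    (hζ : DifferentiableAt ℝ ζ p.2) (v : Eu N) (s : ℝ) :
    fderiv ℝ (fun q : Eu N × ℝ => Φ q.1 * ζ q.2) p (v, s) =
      fderiv ℝ Φ p.1 v * ζ p.2 + Φ p.1 * (s * deriv ζ p.2) := by
  have h1 : HasFDerivAt (fun q : Eu N × ℝ => Φ q.1) _ p := hΦ.hasFDerivAt.comp p hasFDerivAt_fst
  have h2 : HasFDerivAt (fun q : Eu N × ℝ => ζ q.2) _ p :=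
    hζ.hasDerivAt.hasFDerivAt.comp p hasFDerivAt_snd
  have h3 : HasFDerivAt (fun q : Eu N × ℝ => Φ q.1 * ζ q.2) _ p := h1.mul h2
  rw [h3.fderiv]
  simp
  ring

lemma ptder_mul_snd (hΦ : ContDiff ℝ (⊤ : ℕ∞) Φ) (hζ : ContDiff ℝ (⊤ : ℕ∞) ζ) (p : Eu N × ℝ) :
    ptder (fun q : Eu N × ℝ => Φ q.1 * ζ q.2) p = Φ p.1 * deriv ζ p.2 := by
  rw [ptder, fderiv_mul_snd p (hΦ.differentiable (by norm_cast) _)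
    (hζ.differentiable (by norm_cast) _)]
  simp

lemma lapX_mul_snd (hΦ : ContDiff ℝ (⊤ : ℕ∞) Φ) (hζ : ContDiff ℝ (⊤ : ℕ∞) ζ) (p : Eu N × ℝ) :
    lapX (fun q : Eu N × ℝ => Φ q.1 * ζ q.2) p = lapS Φ p.1 * ζ p.2 := by
  have hdζ := hζ.differentiable (by norm_cast)
  have hfΦ : ∀ v, Differentiable ℝ fun y => fderiv ℝ Φ y v := fun v =>
    ((hΦ.fderiv_right (m := (⊤ : ℕ∞)) (by norm_cast)).differentiable
      (by norm_cast)).clm_apply (differentiable_const v)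
  rw [lapX, lapS, Finset.sum_mul]
  refine Finset.sum_congr rfl fun i _ => ?_
  have e : (fun q : Eu N × ℝ => fderiv ℝ (fun r : Eu N × ℝ => Φ r.1 * ζ r.2) q
      (EuclideanSpace.single i 1, 0)) =
      fun q => fderiv ℝ Φ q.1 (EuclideanSpace.single i 1) * ζ q.2 := by
    ext q
    rw [fderiv_mul_snd q (hΦ.differentiable (by norm_cast) _) (hdζ _)]
    simp
  rw [e, fderiv_mul_snd p (hfΦ _ _) (hdζ _)]
  simp

end ProductTest

lemma contDiff_fderiv_apply {N : ℕ} {ψ : Eu N × ℝ → ℝ} (hψ : ContDiff ℝ (⊤ : ℕ∞) ψ)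
    (v : Eu N × ℝ) : ContDiff ℝ (⊤ : ℕ∞) (fun p => fderiv ℝ ψ p v) :=
  (hψ.fderiv_right (m := (⊤ : ℕ∞)) (by norm_cast)).clm_apply contDiff_const

section Integrability

variable {N : ℕ}

/-- Products of a slicewise bounded function with an integrable one are integrable. -/
lemma integrable_bounded_mul {V : Eu N → ℝ → ℝ} {M : ℝ} {F : Eu N × ℝ → ℝ}
    (hV : AEStronglyMeasurable (fun p : Eu N × ℝ => V p.1 p.2)
      ((volume : Measure (Eu N)).prod (volume.restrict (Ioi 0))))
    (hVs : ∀ t, 0 < t → AEStronglyMeasurable (fun x => V x t) volume)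
    (hb : ∀ t, 0 < t → ∀ᵐ x, |V x t| ≤ M)
    (hF : Integrable F ((volume : Measure (Eu N)).prod (volume.restrict (Ioi 0)))) :
    Integrable (fun p => V p.1 p.2 * F p)
      ((volume : Measure (Eu N)).prod (volume.restrict (Ioi 0))) := by
  have hslice : ∀ᵐ t ∂(volume.restrict (Ioi (0 : ℝ))),
      Integrable (fun x => V x t * F (x, t)) volume := by
    filter_upwards [hF.prod_left_ae, ae_restrict_mem measurableSet_Ioi] with t ht h0
    exact ht.bdd_mul (hVs t h0) (hb t h0)
  refine integrable_prod_of_slice_bound (B := fun t => M * ∫ x, ‖F (x, t)‖)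
    (hV.mul hF.aestronglyMeasurable) (hF.norm.integral_prod_right.const_mul M) hslice ?_
  filter_upwards [hF.prod_left_ae, ae_restrict_mem measurableSet_Ioi, hslice] with t ht h0 hs
  rw [← integral_const_mul]
  refine integral_mono_ae hs.norm (ht.norm.const_mul M) ?_
  filter_upwards [hb t h0] with x hx
  simp only [norm_mul]
  exact mul_le_mul_of_nonneg_right hx (norm_nonneg _)

namespace WeightedFlow

variable {ρ : Eu N → ℝ} {u : Eu N → ℝ → ℝ} {A M : ℝ}

lemma integrable_mul_slice (h : WeightedFlow ρ u A M) {t : ℝ} (ht : 0 < t) {F : Eu N → ℝ} {C : ℝ}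
    (hF : AEStronglyMeasurable F volume) (hC : ∀ x, |F x| ≤ C) :
    Integrable (fun x => u x t * F x * ρ x) := by
  refine ((h.int t ht).bdd_mul (f := F) hF (Eventually.of_forall hC)).congr ?_
  exact Eventually.of_forall fun x => by ring

lemma integrable_mul (h : WeightedFlow ρ u A M) {F : Eu N × ℝ → ℝ} (hF : Continuous F)
    (hc : HasCompactSupport F) :
    Integrable (fun p : Eu N × ℝ => u p.1 p.2 * F p * ρ p.1)
      ((volume : Measure (Eu N)).prod (volume.restrict (Ioi 0))) := by
  obtain ⟨C, hC⟩ := hc.exists_bound_of_continuous hF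
  simp only [Real.norm_eq_abs] at hC
  have hS : IsCompact (Prod.snd '' tsupport F) := hc.isCompact.image continuous_snd
  have hsl : ∀ t, 0 < t → Integrable (fun x => u x t * F (x, t) * ρ x) := fun t ht =>
    h.integrable_mul_slice ht
      (hF.comp (by fun_prop : Continuous fun x : Eu N => (x, t))).aestronglyMeasurable fun x => hC _
  have hC0 : 0 ≤ C := (abs_nonneg _).trans (hC (0, 0))
  refine integrable_prod_of_slice_bound
    (B := (Prod.snd '' tsupport F).indicator fun _ => C * A) ?_ ?_ ?_ ?_
  · exact (h.aesm.mul hF.aestronglyMeasurable).mul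
      (h.measurable_weight.comp measurable_fst).aestronglyMeasurable
  · refine IntegrableOn.integrable_indicator ?_ hS.measurableSet
    exact integrableOn_const ((Measure.restrict_apply_le _ _).trans_lt hS.measure_lt_top).ne
  · filter_upwards [ae_restrict_mem measurableSet_Ioi] with t ht using hsl t ht
  · filter_upwards [ae_restrict_mem measurableSet_Ioi] with t ht
    have ht0 : 0 < t := ht
    by_cases hm : t ∈ Prod.snd '' tsupport F
    · rw [indicator_of_mem hm, ← h.mass t ht, ← integral_const_mul]
      refine integral_mono_ae (hsl t ht).norm ((h.int t ht).const_mul C) ?_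
      filter_upwards [h.nonneg t ht, h.weight_pos] with x hx hρ
      simp only [norm_mul, Real.norm_of_nonneg hx, Real.norm_of_nonneg hρ.le, Real.norm_eq_abs]
      have := mul_le_mul_of_nonneg_left (hC (x, t)) (mul_nonneg hx hρ.le)
      linarith
    · rw [indicator_of_notMem hm]
      have hz : ∀ x, F (x, t) = 0 := fun x => by
        by_contra hne
        exact hm ⟨(x, t), subset_tsupport F hne, rfl⟩
      simp [hz]

lemma continuousOn_integral (h : WeightedFlow ρ u A M) {F : Eu N → ℝ} {C : ℝ}
    (hF : AEStronglyMeasurable F volume) (hC : ∀ x, |F x| ≤ C) :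
    ContinuousOn (fun t => ∫ x, u x t * F x * ρ x) (Ioi 0) := by
  intro s hs
  have hs0 : 0 < s := hs
  refine ContinuousAt.continuousWithinAt ?_
  rw [ContinuousAt, tendsto_iff_norm_sub_tendsto_zero]
  have hlim := (h.cont s hs).const_mul C
  rw [mul_zero] at hlim
  refine squeeze_zero' (Eventually.of_forall fun _ => norm_nonneg _) ?_ hlim
  filter_upwards [Ioi_mem_nhds hs0] with t ht
  rw [← integral_sub (h.integrable_mul_slice ht hF hC) (h.integrable_mul_slice hs hF hC),
    ← integral_const_mul]
  have hd : Integrable fun x => |u x t - u x s| * ρ x := by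
    refine ((h.int t ht).sub (h.int s hs)).norm.congr ?_
    filter_upwards [h.weight_pos] with x hρ
    simp only [Pi.sub_apply, ← sub_mul, norm_mul, Real.norm_of_nonneg hρ.le, Real.norm_eq_abs]
  refine norm_integral_le_of_norm_le (hd.const_mul C) ?_
  filter_upwards [h.weight_pos] with x hρ
  rw [← sub_mul, ← sub_mul]
  simp only [norm_mul, Real.norm_of_nonneg hρ.le, Real.norm_eq_abs]
  have := mul_le_mul_of_nonneg_left (hC x) (mul_nonneg (abs_nonneg (u x t - u x s)) hρ.le)
  linarith

/-- Fubini for product test functions. -/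
lemma integral_mul_snd (h : WeightedFlow ρ u A M) {Φ : Eu N → ℝ} {ζ : ℝ → ℝ} (hΦ : Continuous Φ)
    (hΦc : HasCompactSupport Φ) (hζ : Continuous ζ) (hζc : HasCompactSupport ζ)
    (hζ0 : ∀ t ≤ 0, ζ t = 0) :
    ∫ p : Eu N × ℝ, u p.1 p.2 * (Φ p.1 * ζ p.2) * ρ p.1
        ∂((volume : Measure (Eu N)).prod (volume.restrict (Ioi 0))) =
      ∫ t, (∫ x, u x t * Φ x * ρ x) * ζ t := by
  rw [integral_prod_symm _ (h.integrable_mul (F := fun p => Φ p.1 * ζ p.2)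
    ((hΦ.comp continuous_fst).mul (hζ.comp continuous_snd)) (hasCompactSupport_mul_snd hΦc hζc))]
  rw [← setIntegral_eq_integral_of_forall_compl_eq_zero (s := Ioi (0 : ℝ))
    (f := fun t => (∫ x, u x t * Φ x * ρ x) * ζ t)
    fun t ht => by rw [hζ0 t (not_lt.1 ht), mul_zero]]
  refine integral_congr_ae (Eventually.of_forall fun t => ?_)
  simp only
  rw [← integral_mul_const]
  exact integral_congr_ae (Eventually.of_forall fun x => by ring)

end WeightedFlow

end Integrability

/-! ### Monotonicity in time from the Aronson–Bénilan inequality -/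

lemma integrable_mul_of_tsupport_subset {P ζ : ℝ → ℝ} {S : Set ℝ} (hP : ContinuousOn P S)
    (hζ : Continuous ζ) (hc : HasCompactSupport ζ) (hs : tsupport ζ ⊆ S) :
    Integrable (fun x => P x * ζ x) := by
  have : IntegrableOn (fun x => P x * ζ x) (tsupport ζ) :=
    ((hP.mono hs).mul hζ.continuousOn).integrableOn_compact hc
  refine (integrableOn_iff_integrable_of_support_subset ?_).1 this
  exact (Function.support_mul_subset_right _ _).trans subset_closure

lemma tsupport_mul_subset_of_right {P ζ : ℝ → ℝ} {S : Set ℝ} (hs : tsupport ζ ⊆ S) :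
    tsupport (fun x => P x * ζ x) ⊆ S :=
  (tsupport_mul_subset_right (f := P) (g := ζ)).trans hs

lemma contDiff_rpow_mul (q : ℝ) {ζ : ℝ → ℝ} (hζ : ContDiff ℝ (⊤ : ℕ∞) ζ)
    (hs : tsupport ζ ⊆ Ioi 0) : ContDiff ℝ (⊤ : ℕ∞) (fun t => t ^ q * ζ t) := by
  refine contDiff_iff_contDiffAt.2 fun t => ?_
  by_cases ht : t ∈ tsupport ζ
  · have h0 : t ≠ 0 := ne_of_gt (hs ht)
    exact (Real.contDiffAt_rpow_const_of_ne h0).mul hζ.contDiffAt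
  · have h0 : (fun t => t ^ q * ζ t) =ᶠ[𝓝 t] fun _ => 0 := by
      filter_upwards [notMem_tsupport_iff_eventuallyEq.1 ht] with y hy
      simp [hy]
    exact contDiffAt_const.congr_of_eventuallyEq h0

lemma deriv_rpow_mul (q : ℝ) {ζ : ℝ → ℝ} (hζ : ContDiff ℝ (⊤ : ℕ∞) ζ)
    (hs : tsupport ζ ⊆ Ioi 0) (t : ℝ) :
    deriv (fun t => t ^ q * ζ t) t =
      q * (t ^ (-1 : ℝ) * (t ^ q * ζ t)) + t ^ q * deriv ζ t := by
  by_cases ht : t ∈ tsupport ζ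
  · have h0 : 0 < t := hs ht
    have h1 : HasDerivAt (fun t => t ^ q * ζ t) _ t :=
      (Real.hasDerivAt_rpow_const (p := q) (Or.inl h0.ne')).mul
        (hζ.differentiable (by norm_cast) t).hasDerivAt
    rw [h1.deriv, sub_eq_add_neg q 1, Real.rpow_add h0]
    ring
  · have hz := notMem_tsupport_iff_eventuallyEq.1 ht
    have h0 : (fun t => t ^ q * ζ t) =ᶠ[𝓝 t] fun _ => 0 := by
      filter_upwards [hz] with y hy
      simp [hy]
    rw [h0.deriv_eq, hz.deriv_eq, hz.self_of_nhds]
    simp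

/-- A locally integrable function with non-negative integral against all non-negative test
functions is non-negative. -/
lemma ae_nonneg_of_forall_integral_mul_nonneg {N : ℕ} {f : Eu N → ℝ}
    (hf : LocallyIntegrable f volume)
    (h : ∀ Φ : Eu N → ℝ, ContDiff ℝ (⊤ : ℕ∞) Φ → HasCompactSupport Φ → (∀ x, 0 ≤ Φ x) →
      0 ≤ ∫ x, Φ x * f x) : ∀ᵐ x, 0 ≤ f x := by
  let b : ℕ → ContDiffBump (0 : Eu N) := fun n =>
    { rIn := 1 / ((n : ℝ) + 1), rOut := 2 * (1 / ((n : ℝ) + 1))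
      rIn_pos := by positivity
      rIn_lt_rOut := by
        have : 0 < 1 / ((n : ℝ) + 1) := by positivity
        linarith }
  have hb : Tendsto (fun n => (b n).rOut) atTop (𝓝 0) := by
    have h0 := (tendsto_one_div_add_atTop_nhds_zero_nat (𝕜 := ℝ)).const_mul 2
    rwa [mul_zero] at h0
  filter_upwards [ContDiffBump.ae_convolution_tendsto_right_of_locallyIntegrable (K := 2) hb
    (Eventually.of_forall fun n => le_rfl) hf] with x hx
  refine ge_of_tendsto' hx fun n => ?_
  have e : convolution ((b n).normed volume) f (ContinuousLinearMap.lsmul ℝ ℝ) volume x =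
      ∫ y, (b n).normed volume (x - y) * f y := by
    rw [convolution_eq_swap]
    rfl
  rw [e]
  refine h _ ((b n).contDiff_normed.comp (contDiff_const.sub contDiff_id)) ?_
    fun y => (b n).nonneg_normed _
  exact (b n).hasCompactSupport_normed.comp_homeomorph (Homeomorph.subLeft x)

namespace WeightedFlow

variable {N : ℕ} {ρ : Eu N → ℝ} {u : Eu N → ℝ → ℝ} {A M m : ℝ}

lemma integral_mul_nonneg (h : WeightedFlow ρ u A M) {Φ : Eu N → ℝ} (hΦ0 : ∀ x, 0 ≤ Φ x) {t : ℝ}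
    (ht : 0 < t) : 0 ≤ ∫ x, u x t * Φ x * ρ x := by
  refine integral_nonneg_of_ae ?_
  filter_upwards [h.nonneg t ht, h.weight_pos] with x hx hρ
  exact mul_nonneg (mul_nonneg hx (hΦ0 x)) hρ.le

lemma continuousOn_integral_mul (h : WeightedFlow ρ u A M) {Φ : Eu N → ℝ} (hΦ : Continuous Φ)
    (hΦc : HasCompactSupport Φ) : ContinuousOn (fun t => ∫ x, u x t * Φ x * ρ x) (Ioi 0) := by
  obtain ⟨C, hC⟩ := hΦc.exists_bound_of_continuous hΦ
  exact h.continuousOn_integral hΦ.aestronglyMeasurable hC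

set_option maxHeartbeats 1000000 in
/-- The Aronson–Bénilan inequality `ρ w ≥ -ρ u / ((m-1)t)` for the weak time derivative `w`,
tested against `Φ(x) ζ(t)`. -/
lemma integral_mul_deriv_le (h : WeightedFlow ρ u A M) (hm : 1 < m) {w : Eu N → ℝ → ℝ}
    (hw : ∀ φ : Eu N × ℝ → ℝ, ContDiff ℝ (⊤ : ℕ∞) φ → HasCompactSupport φ →
      tsupport φ ⊆ (univ : Set (Eu N)) ×ˢ Ioi 0 →
      ∫ p in (univ : Set (Eu N)) ×ˢ Ioi (0:ℝ), u p.1 p.2 * ptder φ p * ρ p.1 =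
        -∫ p in (univ : Set (Eu N)) ×ˢ Ioi (0:ℝ), w p.1 p.2 * φ p * ρ p.1)
    (hAB : ∀ᵐ p ∂(volume.restrict ((univ : Set (Eu N)) ×ˢ Ioi 0) : Measure (Eu N × ℝ)),
      -(ρ p.1 * u p.1 p.2) / ((m - 1) * p.2) ≤ ρ p.1 * w p.1 p.2)
    {Φ : Eu N → ℝ} {ζ : ℝ → ℝ} (hΦ : ContDiff ℝ (⊤ : ℕ∞) Φ) (hΦc : HasCompactSupport Φ)
    (hΦ0 : ∀ x, 0 ≤ Φ x) (hζ : ContDiff ℝ (⊤ : ℕ∞) ζ) (hζc : HasCompactSupport ζ)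
    (hζs : tsupport ζ ⊆ Ioi 0) (hζ0 : ∀ t, 0 ≤ ζ t) :
    ∫ t, (∫ x, u x t * Φ x * ρ x) * deriv ζ t ≤
      (m - 1)⁻¹ * ∫ t, (∫ x, u x t * Φ x * ρ x) * (t ^ (-1 : ℝ) * ζ t) := by
  have hz : ∀ t ≤ 0, ζ t = 0 := fun t ht =>
    image_eq_zero_of_notMem_tsupport fun hh => absurd (hζs hh) (not_lt.2 ht)
  have hz' : ∀ t ≤ 0, deriv ζ t = 0 := fun t ht => by
    have : t ∉ tsupport ζ := fun hh => absurd (hζs hh) (not_lt.2 ht)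
    rw [(notMem_tsupport_iff_eventuallyEq.1 this).deriv_eq]
    simp
  have hk : 0 < (m - 1)⁻¹ := inv_pos.2 (by linarith)
  have hξ := contDiff_rpow_mul (-1) hζ hζs
  have hξc : HasCompactSupport fun t => t ^ (-1 : ℝ) * ζ t := hζc.mul_left
  have key := hw _ (contDiff_mul_snd hΦ hζ) (hasCompactSupport_mul_snd hΦc hζc)
    (tsupport_mul_snd_subset_univ_prod hζs)
  simp only [ptder_mul_snd hΦ hζ, restrict_univ_prod_Ioi] at key hAB
  rw [h.integral_mul_snd hΦ.continuous hΦc (hζ.continuous_deriv (by norm_cast)) hζc.deriv hz']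
    at key
  rw [key, ← h.integral_mul_snd hΦ.continuous hΦc hξ.continuous hξc
    fun t ht => by rw [hz t ht, mul_zero]]
  by_cases hi : Integrable (fun p : Eu N × ℝ => w p.1 p.2 * (Φ p.1 * ζ p.2) * ρ p.1)
      ((volume : Measure (Eu N)).prod (volume.restrict (Ioi 0)))
  · rw [← integral_neg, ← integral_const_mul]
    have i2 := h.integrable_mul (contDiff_mul_snd hΦ hξ).continuous
      (hasCompactSupport_mul_snd hΦc hξc)
    refine integral_mono_ae hi.neg (i2.const_mul _) ?_
    filter_upwards [hAB] with p hp
    have h1 := mul_le_mul_of_nonneg_right hp (mul_nonneg (hΦ0 p.1) (hζ0 p.2))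
    rw [Real.rpow_neg_one]
    have e : -(ρ p.1 * u p.1 p.2) / ((m - 1) * p.2) =
        -((m - 1)⁻¹ * (ρ p.1 * u p.1 p.2 * p.2⁻¹)) := by
      rw [neg_div, div_eq_mul_inv, mul_inv]
      ring
    rw [e] at h1
    linarith
  · rw [integral_undef hi, neg_zero, h.integral_mul_snd hΦ.continuous hΦc hξ.continuous hξc
      fun t ht => by rw [hz t ht, mul_zero]]
    refine mul_nonneg hk.le (integral_nonneg fun t => ?_)
    rcases le_or_gt t 0 with ht | ht
    · simp [hz t ht]
    · exact mul_nonneg (h.integral_mul_nonneg hΦ0 ht)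
        (mul_nonneg (Real.rpow_nonneg ht.le _) (hζ0 t))

/-- `t ↦ t^{1/(m-1)} u(x,t)` is non-decreasing. -/
lemma rpow_mul_le_rpow_mul (h : WeightedFlow ρ u A M) (hm : 1 < m) {w : Eu N → ℝ → ℝ}
    (hw : ∀ φ : Eu N × ℝ → ℝ, ContDiff ℝ (⊤ : ℕ∞) φ → HasCompactSupport φ →
      tsupport φ ⊆ (univ : Set (Eu N)) ×ˢ Ioi 0 →
      ∫ p in (univ : Set (Eu N)) ×ˢ Ioi (0:ℝ), u p.1 p.2 * ptder φ p * ρ p.1 =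
        -∫ p in (univ : Set (Eu N)) ×ˢ Ioi (0:ℝ), w p.1 p.2 * φ p * ρ p.1)
    (hAB : ∀ᵐ p ∂(volume.restrict ((univ : Set (Eu N)) ×ˢ Ioi 0) : Measure (Eu N × ℝ)),
      -(ρ p.1 * u p.1 p.2) / ((m - 1) * p.2) ≤ ρ p.1 * w p.1 p.2)
    {s t : ℝ} (hs : 0 < s) (hst : s ≤ t) :
    ∀ᵐ x, s ^ (m - 1)⁻¹ * u x s ≤ t ^ (m - 1)⁻¹ * u x t := by
  have ht : 0 < t := hs.trans_le hst
  have hdiff : Integrable fun x => t ^ (m - 1)⁻¹ * (u x t * ρ x) - s ^ (m - 1)⁻¹ * (u x s * ρ x) :=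
    ((h.int t ht).const_mul _).sub ((h.int s hs).const_mul _)
  have hpos := ae_nonneg_of_forall_integral_mul_nonneg hdiff.locallyIntegrable
    fun Φ hΦ hΦc hΦ0 => ?_
  · filter_upwards [hpos, h.weight_pos] with x hx hρ
    have : 0 ≤ (t ^ (m - 1)⁻¹ * u x t - s ^ (m - 1)⁻¹ * u x s) * ρ x := by linarith
    linarith [nonneg_of_mul_nonneg_left this hρ]
  obtain ⟨C, hC⟩ := hΦc.exists_bound_of_continuous hΦ.continuous
  have ha := h.continuousOn_integral_mul hΦ.continuous hΦc
  have hle := le_of_forall_integral_mul_deriv_nonpos (a := 0) (b := t + 1) (s := s) (t := t)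
    (f := fun τ => τ ^ (m - 1)⁻¹ * ∫ x, u x τ * Φ x * ρ x) ?_ (fun η hη hηc hηs hη0 => ?_) hs hst
    (by linarith)
  · have e : ∫ x, Φ x * (t ^ (m - 1)⁻¹ * (u x t * ρ x) - s ^ (m - 1)⁻¹ * (u x s * ρ x)) =
        t ^ (m - 1)⁻¹ * (∫ x, u x t * Φ x * ρ x) - s ^ (m - 1)⁻¹ * ∫ x, u x s * Φ x * ρ x := by
      rw [← integral_const_mul, ← integral_const_mul, ← integral_sub
        ((h.integrable_mul_slice ht hΦ.continuous.aestronglyMeasurable hC).const_mul _)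
        ((h.integrable_mul_slice hs hΦ.continuous.aestronglyMeasurable hC).const_mul _)]
      exact integral_congr_ae (Eventually.of_forall fun x => by ring)
    rw [e]
    linarith
  · exact (continuousOn_id.rpow_const fun x hx => Or.inl (ne_of_gt hx.1)).mul
      (ha.mono Ioo_subset_Ioi_self)
  · have hηs' : tsupport η ⊆ Ioi 0 := hηs.trans Ioo_subset_Ioi_self
    have hζ := contDiff_rpow_mul (m - 1)⁻¹ hη hηs'
    have hζc : HasCompactSupport fun t => t ^ (m - 1)⁻¹ * η t := hηc.mul_left
    have hζs : tsupport (fun t => t ^ (m - 1)⁻¹ * η t) ⊆ Ioi 0 := tsupport_mul_subset_of_right hηs'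
    have hζ0 : ∀ τ : ℝ, 0 ≤ τ ^ (m - 1)⁻¹ * η τ := fun τ => by
      rcases le_or_gt τ 0 with hτ | hτ
      · rw [image_eq_zero_of_notMem_tsupport fun hh => absurd (hηs' hh) (not_lt.2 hτ), mul_zero]
      · exact mul_nonneg (Real.rpow_nonneg hτ.le _) (hη0 τ)
    have hab := h.integral_mul_deriv_le hm hw hAB hΦ hΦc hΦ0 hζ hζc hζs hζ0
    have hξ := contDiff_rpow_mul (-1) hζ hζs
    have i1 := integrable_mul_of_tsupport_subset ha hξ.continuous hζc.mul_left
      (tsupport_mul_subset_of_right hζs)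
    have i2 : Integrable fun τ => (∫ x, u x τ * Φ x * ρ x) * (τ ^ (m - 1)⁻¹ * deriv η τ) := by
      have hd : ContDiff ℝ (⊤ : ℕ∞) (deriv η) := contDiff_infty_iff_deriv.1 hη |>.2
      have hds := (tsupport_deriv_subset (f := η)).trans hηs'
      exact integrable_mul_of_tsupport_subset ha (contDiff_rpow_mul _ hd hds).continuous
        hηc.deriv.mul_left (tsupport_mul_subset_of_right hds)
    simp only [deriv_rpow_mul _ hη hηs', mul_add] at hab
    rw [integral_add (by simpa only [mul_left_comm] using i1.const_mul (m - 1)⁻¹) i2] at hab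
    simp only [mul_left_comm _ (m - 1)⁻¹] at hab
    rw [integral_const_mul] at hab
    have e : ∫ τ, τ ^ (m - 1)⁻¹ * (∫ x, u x τ * Φ x * ρ x) * deriv η τ =
        ∫ τ, (∫ x, u x τ * Φ x * ρ x) * (τ ^ (m - 1)⁻¹ * deriv η τ) :=
      integral_congr_ae (Eventually.of_forall fun τ => by ring)
    rw [e]
    linarith

end WeightedFlow

/-! ### The very weak form of the equation -/

/-- Test functions on `ℝ^N × (0,∞)`. -/
structure IsTest {N : ℕ} (ψ : Eu N × ℝ → ℝ) : Prop where
  contDiff : ContDiff ℝ (⊤ : ℕ∞) ψ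
  compact : HasCompactSupport ψ
  tsupport_subset : tsupport ψ ⊆ (univ : Set (Eu N)) ×ˢ Ioi 0

namespace IsTest

variable {N : ℕ} {ψ φ : Eu N × ℝ → ℝ}

lemma add (hψ : IsTest ψ) (hφ : IsTest φ) : IsTest (fun p => ψ p + φ p) :=
  ⟨hψ.contDiff.add hφ.contDiff, hψ.compact.add hφ.compact,
    (tsupport_add ψ φ).trans (union_subset hψ.tsupport_subset hφ.tsupport_subset)⟩

lemma mul_left (hψ : IsTest ψ) {f : Eu N × ℝ → ℝ} (hf : ContDiff ℝ (⊤ : ℕ∞) f) :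
    IsTest (fun p => f p * ψ p) :=
  ⟨hf.mul hψ.contDiff, hψ.compact.mul_left,
    (tsupport_mul_subset_right (f := f) (g := ψ)).trans hψ.tsupport_subset⟩

lemma fderiv_apply (hψ : IsTest ψ) (v : Eu N × ℝ) : IsTest (fun p => fderiv ℝ ψ p v) := by
  refine ⟨contDiff_fderiv_apply hψ.contDiff v, hψ.compact.fderiv_apply (𝕜 := ℝ) v, ?_⟩
  exact (tsupport_fderiv_apply_subset ℝ v).trans hψ.tsupport_subset

lemma mul_snd {Φ : Eu N → ℝ} {ζ : ℝ → ℝ} (hΦ : ContDiff ℝ (⊤ : ℕ∞) Φ) (hΦc : HasCompactSupport Φ)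
    (hζ : ContDiff ℝ (⊤ : ℕ∞) ζ) (hζc : HasCompactSupport ζ) (hζs : tsupport ζ ⊆ Ioi 0) :
    IsTest (fun p : Eu N × ℝ => Φ p.1 * ζ p.2) :=
  ⟨contDiff_mul_snd hΦ hζ, hasCompactSupport_mul_snd hΦc hζc,
    tsupport_mul_snd_subset_univ_prod hζs⟩

lemma integrable (hψ : IsTest ψ) :
    Integrable ψ ((volume : Measure (Eu N)).prod (volume.restrict (Ioi 0))) := by
  rw [← restrict_univ_prod_Ioi]
  exact (hψ.contDiff.continuous.integrable_of_hasCompactSupport hψ.compact).integrableOn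

lemma differentiableAt (hψ : IsTest ψ) (p : Eu N × ℝ) : DifferentiableAt ℝ ψ p :=
  hψ.contDiff.differentiable (by norm_cast) p

end IsTest

/-- The pairing of a vector field with the spatial gradient of a test function. -/
def gradPairing {N : ℕ} (g : Eu N → ℝ → Eu N) (ψ : Eu N × ℝ → ℝ) (p : Eu N × ℝ) : ℝ :=
  ∑ i : Fin N, g p.1 p.2 i * fderiv ℝ ψ p (EuclideanSpace.single i 1, 0)

lemma gradPairing_add {N : ℕ} (g : Eu N → ℝ → Eu N) {ψ φ : Eu N × ℝ → ℝ} (hψ : IsTest ψ)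
    (hφ : IsTest φ) (p : Eu N × ℝ) :
    gradPairing g (fun p => ψ p + φ p) p = gradPairing g ψ p + gradPairing g φ p := by
  simp only [gradPairing, fderiv_fun_add (hψ.differentiableAt p) (hφ.differentiableAt p),
    add_apply, mul_add, Finset.sum_add_distrib]

lemma gradPairing_coord_mul {N : ℕ} (g : Eu N → ℝ → Eu N) {ψ : Eu N × ℝ → ℝ} (hψ : IsTest ψ)
    (i : Fin N) (p : Eu N × ℝ) :
    gradPairing g (fun p => p.1 i * ψ p) p = g p.1 p.2 i * ψ p + p.1 i * gradPairing g ψ p := by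
  have h1 : HasFDerivAt (fun p : Eu N × ℝ => p.1 i)
      ((EuclideanSpace.proj i : Eu N →L[ℝ] ℝ).comp (ContinuousLinearMap.fst ℝ (Eu N) ℝ)) p :=
    ((EuclideanSpace.proj i : Eu N →L[ℝ] ℝ).comp
      (ContinuousLinearMap.fst ℝ (Eu N) ℝ)).hasFDerivAt
  have h2 : HasFDerivAt (fun p : Eu N × ℝ => p.1 i * ψ p) _ p :=
    h1.mul (hψ.differentiableAt p).hasFDerivAt
  have h3 : ∀ j : Fin N, fderiv ℝ (fun p : Eu N × ℝ => p.1 i * ψ p) p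
      (EuclideanSpace.single j 1, 0) =
      p.1 i * fderiv ℝ ψ p (EuclideanSpace.single j 1, 0) + if i = j then ψ p else 0 := fun j => by
    rw [h2.fderiv]
    simp
  simp only [gradPairing, h3, mul_add, Finset.sum_add_distrib, Finset.mul_sum, mul_ite, mul_zero,
    Finset.sum_ite_eq, Finset.mem_univ, if_true]
  rw [add_comm]
  congr 1
  exact Finset.sum_congr rfl fun j _ => by ring

/-- If `∑ gᵢ ∂ᵢψ` is integrable for all test functions then so is every `gᵢ φ`. -/
lemma integrable_coord_mul {N : ℕ} {g : Eu N → ℝ → Eu N} {μ : Measure (Eu N × ℝ)}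
    (hg : ∀ ψ, IsTest ψ → Integrable (gradPairing g ψ) μ) {φ : Eu N × ℝ → ℝ} (hφ : IsTest φ)
    (i : Fin N) : Integrable (fun p => g p.1 p.2 i * φ p) μ := by
  have hcoord : ContDiff ℝ (⊤ : ℕ∞) (fun p : Eu N × ℝ => p.1 i) :=
    ((EuclideanSpace.proj i : Eu N →L[ℝ] ℝ).comp (ContinuousLinearMap.fst ℝ (Eu N) ℝ)).contDiff
  obtain ⟨C, hC⟩ := hφ.compact.isCompact.exists_bound_of_continuousOn
    hcoord.continuous.continuousOn
  have h1 := hg _ (hφ.mul_left hcoord)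
  have h2 : Integrable (fun p : Eu N × ℝ =>
      (tsupport φ).indicator (fun p => p.1 i) p * gradPairing g φ p) μ := by
    refine (hg _ hφ).bdd_mul (c := max C 0)
      (hcoord.continuous.measurable.indicator
        (isClosed_tsupport φ).measurableSet).aestronglyMeasurable
      (Eventually.of_forall fun p => ?_)
    by_cases hp : p ∈ tsupport φ
    · rw [indicator_of_mem hp]
      exact (hC p hp).trans (le_max_left _ _)
    · simp [indicator_of_notMem hp]
  refine (h1.sub h2).congr (Eventually.of_forall fun p => ?_)
  simp only [Pi.sub_apply, gradPairing_coord_mul g hφ]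
  by_cases hp : p ∈ tsupport φ
  · rw [indicator_of_mem hp]
    ring
  · have hz : gradPairing g φ p = 0 := Finset.sum_eq_zero fun j _ => by
      rw [(notMem_tsupport_iff_eventuallyEq.1 hp).fderiv_eq]
      simp
    rw [indicator_of_notMem hp, hz]
    ring

lemma spow_of_nonneg {a m : ℝ} (ha : 0 ≤ a) (hm : 1 < m) : spow a m = a ^ m := by
  rcases ha.eq_or_lt with rfl | h
  · rw [spow, mul_zero, Real.zero_rpow (by linarith)]
  · rw [spow, abs_of_pos h, Real.rpow_sub_one h.ne', div_mul_cancel₀ _ h.ne']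

lemma measurable_spow (m : ℝ) : Measurable fun a => spow a m :=
  (measurable_id.abs.pow_const (m - 1)).mul measurable_id

section Slices

variable {N : ℕ}

lemma integral_prod_mono_of_slice {F G : Eu N × ℝ → ℝ}
    (hF : Integrable F ((volume : Measure (Eu N)).prod (volume.restrict (Ioi 0))))
    (hG : Integrable G ((volume : Measure (Eu N)).prod (volume.restrict (Ioi 0))))
    (h : ∀ t, 0 < t → ∀ᵐ x, F (x, t) ≤ G (x, t)) :
    ∫ p, F p ∂((volume : Measure (Eu N)).prod (volume.restrict (Ioi 0))) ≤
      ∫ p, G p ∂((volume : Measure (Eu N)).prod (volume.restrict (Ioi 0))) := by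
  rw [integral_prod_symm _ hF, integral_prod_symm _ hG]
  refine integral_mono_ae hF.integral_prod_right hG.integral_prod_right ?_
  filter_upwards [hF.prod_left_ae, hG.prod_left_ae, ae_restrict_mem measurableSet_Ioi]
    with t h1 h2 h3
  exact integral_mono_ae h1 h2 (h t h3)

variable {ρ : Eu N → ℝ} {u : Eu N → ℝ → ℝ} {A M m : ℝ}

namespace WeightedFlow

lemma spow_slice (h : WeightedFlow ρ u A M) (hm : 1 < m) {t : ℝ} (ht : 0 < t) :
    ∀ᵐ x, 0 ≤ spow (u x t) m ∧ spow (u x t) m = u x t ^ m ∧ |spow (u x t) m| ≤ M ^ m := by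
  filter_upwards [h.nonneg t ht, h.bdd t ht] with x h0 hM
  have e := spow_of_nonneg h0 hm
  have hp : 0 ≤ u x t ^ m := Real.rpow_nonneg h0 m
  rw [e]
  refine ⟨hp, rfl, ?_⟩
  rw [abs_of_nonneg hp]
  exact Real.rpow_le_rpow h0 ((le_abs_self _).trans hM) (by linarith)

lemma aesm_spow_slice (h : WeightedFlow ρ u A M) (m : ℝ) {t : ℝ} (ht : 0 < t) :
    AEStronglyMeasurable (fun x => spow (u x t) m) volume :=
  ((measurable_spow m).comp_aemeasurable (h.aesm_slice t ht).aemeasurable).aestronglyMeasurable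

lemma integrable_spow_mul (h : WeightedFlow ρ u A M) (hm : 1 < m) {F : Eu N × ℝ → ℝ}
    (hF : Integrable F ((volume : Measure (Eu N)).prod (volume.restrict (Ioi 0)))) :
    Integrable (fun p => spow (u p.1 p.2) m * F p)
      ((volume : Measure (Eu N)).prod (volume.restrict (Ioi 0))) :=
  integrable_bounded_mul (V := fun x t => spow (u x t) m) (M := M ^ m)
    ((measurable_spow m).comp_aemeasurable h.aesm.aemeasurable).aestronglyMeasurable
    (fun _ ht => h.aesm_spow_slice m ht)
    (fun _ ht => (h.spow_slice hm ht).mono fun _ hx => hx.2.2) hF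

end WeightedFlow

/-- Either the left-hand side of the weak equation always vanishes (because the gradient field
is not integrable against some test function), or the very weak formulation holds. -/
lemma WES.very_weak {u₀ : Eu N → ℝ} {g : Eu N → ℝ → Eu N} (hW : WES ρ m u u₀ g)
    (h : WeightedFlow ρ u A M) (hm : 1 < m) :
    (∀ ψ, IsTest ψ → ∫ p : Eu N × ℝ, u p.1 p.2 * ptder ψ p * ρ p.1
      ∂((volume : Measure (Eu N)).prod (volume.restrict (Ioi 0))) = 0) ∨
    ∀ ψ, IsTest ψ → ∫ p : Eu N × ℝ, u p.1 p.2 * ptder ψ p * ρ p.1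
      ∂((volume : Measure (Eu N)).prod (volume.restrict (Ioi 0))) =
      -∫ p : Eu N × ℝ, spow (u p.1 p.2) m * lapX ψ p
        ∂((volume : Measure (Eu N)).prod (volume.restrict (Ioi 0))) := by
  have heq : ∀ ψ, IsTest ψ → ∫ p : Eu N × ℝ, u p.1 p.2 * ptder ψ p * ρ p.1
      ∂((volume : Measure (Eu N)).prod (volume.restrict (Ioi 0))) =
      ∫ p, gradPairing g ψ p ∂((volume : Measure (Eu N)).prod (volume.restrict (Ioi 0))) :=
    fun ψ hψ => by
      have := hW.weakEq ψ hψ.contDiff hψ.compact hψ.tsupport_subset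
      rwa [restrict_univ_prod_Ioi] at this
  by_cases hall : ∀ ψ, IsTest ψ → Integrable (gradPairing g ψ)
      ((volume : Measure (Eu N)).prod (volume.restrict (Ioi 0)))
  · right
    intro ψ hψ
    have hd := fun i : Fin N => hψ.fderiv_apply (EuclideanSpace.single i 1, 0)
    rw [heq ψ hψ]
    simp only [gradPairing, lapX, Finset.mul_sum]
    rw [integral_finsetSum _ fun i _ => integrable_coord_mul hall (hd i) i,
      integral_finsetSum _ fun i _ => h.integrable_spow_mul hm
        ((hd i).fderiv_apply (EuclideanSpace.single i 1, 0)).integrable, ← Finset.sum_neg_distrib]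
    refine Finset.sum_congr rfl fun i _ => ?_
    have := hW.gradProp _ (hd i).contDiff (hd i).compact (hd i).tsupport_subset i
    rw [restrict_univ_prod_Ioi] at this
    rw [this, neg_neg]
  · left
    push Not at hall
    obtain ⟨η, hη, hηi⟩ := hall
    intro ψ hψ
    by_cases hψi : Integrable (gradPairing g ψ)
        ((volume : Measure (Eu N)).prod (volume.restrict (Ioi 0)))
    · have hsum : ¬ Integrable (gradPairing g fun p => ψ p + η p)
          ((volume : Measure (Eu N)).prod (volume.restrict (Ioi 0))) := fun hs =>
        hηi ((hs.sub hψi).congr (Eventually.of_forall fun p => by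
          simp only [Pi.sub_apply, gradPairing_add g hψ hη]
          ring))
      have e1 := heq _ (hψ.add hη)
      have e2 := heq _ hη
      rw [integral_undef hsum] at e1
      rw [integral_undef hηi] at e2
      have e3 : ∀ p : Eu N × ℝ, u p.1 p.2 * ptder (fun p => ψ p + η p) p * ρ p.1 =
          u p.1 p.2 * ptder ψ p * ρ p.1 + u p.1 p.2 * ptder η p * ρ p.1 := fun p => by
        simp only [ptder, fderiv_fun_add (hψ.differentiableAt p) (hη.differentiableAt p),
          add_apply]
        ring
      simp only [e3] at e1
      have i1 : IsTest (ptder ψ) := hψ.fderiv_apply (0, 1)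
      have i2 : IsTest (ptder η) := hη.fderiv_apply (0, 1)
      rw [integral_add (h.integrable_mul i1.contDiff.continuous i1.compact)
        (h.integrable_mul i2.contDiff.continuous i2.compact)] at e1
      linarith
    · rw [heq ψ hψ, integral_undef hψi]

end Slices

/-! ### The Green function estimate -/

section Green

variable {N : ℕ} {ρ : Eu N → ℝ} {u : Eu N → ℝ → ℝ} {A M m : ℝ}

lemma greenKer_nonneg (N : ℕ) {e s : ℝ} (he : 0 < e) (hs : 0 ≤ s) : 0 ≤ greenKer N e s := by
  have := alphaN_pos N
  rw [greenKer]
  exact mul_nonneg (by positivity) (Real.rpow_nonneg (by positivity) _)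

lemma integrable_greenKer_mul_snd (x₀ : Eu N) {r : ℝ} (hr : 0 < r) {η : ℝ → ℝ}
    (hη : Continuous η) (hηc : HasCompactSupport η) :
    Integrable (fun p : Eu N × ℝ => greenKer N (r ^ 2) (‖p.1 - x₀‖ ^ 2) * η p.2)
      ((volume : Measure (Eu N)).prod (volume.restrict (Ioi 0))) := by
  have h1 : Integrable fun x : Eu N => greenKer N (r ^ 2) (‖x - x₀‖ ^ 2) := by
    simpa using integrable_mul_greenKer (f := fun _ : Eu N => (1 : ℝ)) (M := 1)
      aestronglyMeasurable_const (by simp) x₀ hr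
  exact h1.mul_prod (hη.integrable_of_hasCompactSupport hηc).restrict

variable {u₀ : Eu N → ℝ} {g : Eu N → ℝ → Eu N}

lemma WES.integral_truncGreen_mul_deriv_le (hW : WES ρ m u u₀ g) (h : WeightedFlow ρ u A M)
    (hm : 1 < m) (hN : 3 ≤ N) {δ r : ℝ} (hδ : 0 < δ) (hr : 0 < r) (x₀ : Eu N) {η : ℝ → ℝ}
    (hη : ContDiff ℝ (⊤ : ℕ∞) η) (hηc : HasCompactSupport η) (hηs : tsupport η ⊆ Ioi 0)
    (hη0 : ∀ t, 0 ≤ η t) :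
    ∫ t, (∫ x, u x t * truncGreen N δ (r ^ 2) (‖x - x₀‖ ^ 2) * ρ x) * deriv η t ≤
      ∫ p : Eu N × ℝ, spow (u p.1 p.2) m * (greenKer N (r ^ 2) (‖p.1 - x₀‖ ^ 2) * η p.2)
        ∂((volume : Measure (Eu N)).prod (volume.restrict (Ioi 0))) := by
  have he : 0 < r ^ 2 := by positivity
  have hΦ := contDiff_truncGreen (N := N) (δ := δ) he x₀
  have hΦc := hasCompactSupport_truncGreen hN hδ (r ^ 2) x₀
  have htest := IsTest.mul_snd hΦ hΦc hη hηc hηs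
  have iK := h.integrable_spow_mul hm (integrable_greenKer_mul_snd x₀ hr hη.continuous hηc)
  have hz : ∀ t ≤ 0, deriv η t = 0 := fun t ht => by
    have : t ∉ tsupport η := fun hh => absurd (hηs hh) (not_lt.2 ht)
    rw [(notMem_tsupport_iff_eventuallyEq.1 this).deriv_eq]
    simp
  rw [← h.integral_mul_snd hΦ.continuous hΦc (hη.continuous_deriv (by norm_cast)) hηc.deriv hz]
  rcases hW.very_weak h hm with hv | hv
  · have h0 := hv _ htest
    simp only [ptder_mul_snd hΦ hη] at h0
    rw [h0]
    refine (integral_zero (Eu N × ℝ) ℝ).symm.trans_le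
      (integral_prod_mono_of_slice (integrable_zero _ _ _) iK fun t ht => ?_)
    filter_upwards [h.spow_slice hm ht] with x hx
    exact mul_nonneg hx.1 (mul_nonneg (greenKer_nonneg N he (by positivity)) (hη0 t))
  · have h0 := hv _ htest
    simp only [ptder_mul_snd hΦ hη, lapX_mul_snd hΦ hη] at h0
    rw [h0, ← integral_neg]
    have iL : Integrable (fun p : Eu N × ℝ => lapX (fun q : Eu N × ℝ =>
        truncGreen N δ (r ^ 2) (‖q.1 - x₀‖ ^ 2) * η q.2) p)
        ((volume : Measure (Eu N)).prod (volume.restrict (Ioi 0))) :=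
      integrable_finsetSum _ fun i _ => ((htest.fderiv_apply _).fderiv_apply _).integrable
    simp only [lapX_mul_snd hΦ hη] at iL
    refine integral_prod_mono_of_slice (h.integrable_spow_mul hm iL).neg iK fun t ht => ?_
    filter_upwards [h.spow_slice hm ht] with x hx
    have h1 := mul_le_mul_of_nonneg_left (mul_le_mul_of_nonneg_right
      (neg_lapS_truncGreen_le hN hδ he x₀ x) (hη0 t)) hx.1
    linarith

/-- The potential estimate with the regularised Green function. -/
lemma WES.integral_truncGreen_sub_le (hW : WES ρ m u u₀ g) (h : WeightedFlow ρ u A M)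
    (hm : 1 < m) (hN : 3 ≤ N) {t₀ t₁ : ℝ} (ht₀ : 0 < t₀) (ht : t₀ < t₁)
    (hmono : ∀ t, 0 < t → t ≤ t₁ → ∀ᵐ x, t ^ (m - 1)⁻¹ * u x t ≤ t₁ ^ (m - 1)⁻¹ * u x t₁)
    {δ r : ℝ} (hδ : 0 < δ) (hr : 0 < r) (x₀ : Eu N) :
    (∫ x, u x t₀ * truncGreen N δ (r ^ 2) (‖x - x₀‖ ^ 2) * ρ x) -
        ∫ x, u x t₁ * truncGreen N δ (r ^ 2) (‖x - x₀‖ ^ 2) * ρ x ≤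
      (m - 1) * t₁ ^ (1 + (m - 1)⁻¹) * t₀ ^ (-(m - 1)⁻¹) *
        ∫ x, spow (u x t₁) m * greenKer N (r ^ 2) (‖x - x₀‖ ^ 2) := by
  have ht₁ : 0 < t₁ := ht₀.trans ht
  have he : 0 < r ^ 2 := by positivity
  have hm1 : 0 < m - 1 := by linarith
  have hΦ := contDiff_truncGreen (N := N) (δ := δ) he x₀
  have hΦc := hasCompactSupport_truncGreen hN hδ (r ^ 2) x₀
  set f : ℝ → ℝ := fun t => ∫ x, u x t * truncGreen N δ (r ^ 2) (‖x - x₀‖ ^ 2) * ρ x with hf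
  have hfc : ContinuousOn f (Ioi 0) := h.continuousOn_integral_mul hΦ.continuous hΦc
  set H : ℝ := ∫ x, spow (u x t₁) m * greenKer N (r ^ 2) (‖x - x₀‖ ^ 2) with hH
  have iU : ∀ t, 0 < t → Integrable fun x =>
      spow (u x t) m * greenKer N (r ^ 2) (‖x - x₀‖ ^ 2) := fun t ht =>
    integrable_mul_greenKer (h.aesm_spow_slice m ht)
      ((h.spow_slice hm ht).mono fun _ hx => hx.2.2) x₀ hr
  have hH0 : 0 ≤ H := integral_nonneg_of_ae <| by
    filter_upwards [h.spow_slice hm ht₁] with x hx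
    exact mul_nonneg hx.1 (greenKer_nonneg N he (by positivity))
  have hpow : (m - 1)⁻¹ * m = 1 + (m - 1)⁻¹ := by
    field_simp
    ring
  have hslice : ∀ t, 0 < t → t ≤ t₁ →
      ∫ x, spow (u x t) m * greenKer N (r ^ 2) (‖x - x₀‖ ^ 2) ≤
        t₁ ^ (1 + (m - 1)⁻¹) * t ^ (-(m - 1)⁻¹ - 1) * H := fun t h0 h1 => by
    rw [hH, ← integral_const_mul]
    refine integral_mono_ae (iU t h0) ((iU t₁ ht₁).const_mul _) ?_
    filter_upwards [hmono t h0 h1, h.spow_slice hm h0, h.spow_slice hm ht₁, h.nonneg t h0,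
      h.nonneg t₁ ht₁] with x hx hs hs₁ hu hu₁
    have hk := Real.rpow_le_rpow (mul_nonneg (Real.rpow_nonneg h0.le _) hu) hx
      (by linarith : 0 ≤ m)
    rw [Real.mul_rpow (Real.rpow_nonneg h0.le _) hu, Real.mul_rpow (Real.rpow_nonneg ht₁.le _) hu₁,
      ← Real.rpow_mul h0.le, ← Real.rpow_mul ht₁.le, hpow, ← hs.2.1, ← hs₁.2.1] at hk
    have e : t ^ (-(m - 1)⁻¹ - 1) = (t ^ (1 + (m - 1)⁻¹))⁻¹ := by
      rw [← Real.rpow_neg h0.le]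
      congr 1
      ring
    have hle : spow (u x t) m ≤ t₁ ^ (1 + (m - 1)⁻¹) * t ^ (-(m - 1)⁻¹ - 1) * spow (u x t₁) m := by
      rw [e, mul_right_comm, ← div_eq_mul_inv, le_div_iff₀ (Real.rpow_pos_of_pos h0 _)]
      linarith
    have := mul_le_mul_of_nonneg_right hle
      (greenKer_nonneg N he (by positivity : 0 ≤ ‖x - x₀‖ ^ 2))
    linarith
  set c : ℝ := (m - 1) * t₁ ^ (1 + (m - 1)⁻¹) * H with hc
  have hc0 : 0 ≤ c := mul_nonneg (mul_nonneg hm1.le (Real.rpow_nonneg ht₁.le _)) hH0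
  have hPc : ContinuousOn (fun t : ℝ => t ^ (-(m - 1)⁻¹)) (Ioi 0) :=
    continuousOn_id.rpow_const fun x hx => Or.inl (ne_of_gt hx)
  have hFc : ContinuousOn (fun t => f t - c * t ^ (-(m - 1)⁻¹)) (Ioi 0) :=
    hfc.sub (hPc.const_smul c)
  have hmonoF : ∀ t, t₀ ≤ t → t < t₁ →
      f t₀ - c * t₀ ^ (-(m - 1)⁻¹) ≤ f t - c * t ^ (-(m - 1)⁻¹) := fun t h0 h1 => by
    refine le_of_forall_integral_mul_deriv_nonpos (a := 0) (b := t₁)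
      (f := fun t => f t - c * t ^ (-(m - 1)⁻¹)) (hFc.mono Ioo_subset_Ioi_self)
      (fun η hη hηc hηs hη0 => ?_) ht₀ h0 h1
    have hηs' := hηs.trans Ioo_subset_Ioi_self
    obtain ⟨iP, iP', hparts⟩ := integral_mul_deriv_add_deriv_mul_eq_zero (a := 0) (b := t₁)
      (P := fun t : ℝ => t ^ (-(m - 1)⁻¹)) (P' := fun t => -(m - 1)⁻¹ * t ^ (-(m - 1)⁻¹ - 1))
      (fun x hx => Real.hasDerivAt_rpow_const (Or.inl (ne_of_gt hx.1)))
      (continuousOn_const.mul (continuousOn_id.rpow_const fun x hx => Or.inl (ne_of_gt hx.1)))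
      hη hηc hηs
    have iF := integrable_mul_of_tsupport_subset hfc (hη.continuous_deriv (by norm_cast))
      hηc.deriv ((tsupport_deriv_subset (f := η)).trans hηs')
    have hmain := hW.integral_truncGreen_mul_deriv_le h hm hN hδ hr x₀ hη hηc hηs' hη0
    have iK := h.integrable_spow_mul hm (integrable_greenKer_mul_snd x₀ hr hη.continuous hηc)
    have hz : ∀ t, t ∉ Ioo 0 t₁ → η t = 0 := fun t ht =>
      image_eq_zero_of_notMem_tsupport fun hh => ht (hηs hh)
    have hrhs : ∫ p : Eu N × ℝ, spow (u p.1 p.2) m * (greenKer N (r ^ 2) (‖p.1 - x₀‖ ^ 2) * η p.2)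
        ∂((volume : Measure (Eu N)).prod (volume.restrict (Ioi 0))) ≤
        -c * ∫ t, -(m - 1)⁻¹ * t ^ (-(m - 1)⁻¹ - 1) * η t := by
      rw [integral_prod_symm _ iK, ← integral_const_mul,
        ← setIntegral_eq_integral_of_forall_compl_eq_zero (s := Ioi (0 : ℝ))
          (f := fun t => -c * (-(m - 1)⁻¹ * t ^ (-(m - 1)⁻¹ - 1) * η t))
          fun t ht => by rw [hz t fun hh => ht hh.1]; ring]
      refine integral_mono_ae iK.integral_prod_right (iP'.const_mul _).restrict ?_
      filter_upwards [ae_restrict_mem measurableSet_Ioi] with t h0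
      have e : ∫ x, spow (u x t) m * (greenKer N (r ^ 2) (‖x - x₀‖ ^ 2) * η t) =
          (∫ x, spow (u x t) m * greenKer N (r ^ 2) (‖x - x₀‖ ^ 2)) * η t := by
        simp only [← mul_assoc]
        exact integral_mul_const _ _
      rw [e]
      by_cases hmem : t ∈ Ioo 0 t₁
      · have h2 := mul_le_mul_of_nonneg_right (hslice t h0 hmem.2.le) (hη0 t)
        have e2 : -c * (-(m - 1)⁻¹ * t ^ (-(m - 1)⁻¹ - 1) * η t) =
            t₁ ^ (1 + (m - 1)⁻¹) * t ^ (-(m - 1)⁻¹ - 1) * H * η t := by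
          rw [hc]
          field_simp
        rw [e2]
        exact h2
      · rw [hz t hmem]
        simp
    have esplit : ∫ t, (f t - c * t ^ (-(m - 1)⁻¹)) * deriv η t =
        (∫ t, f t * deriv η t) - c * ∫ t, t ^ (-(m - 1)⁻¹) * deriv η t := by
      rw [← integral_const_mul, ← integral_sub iF (iP.const_mul c)]
      exact integral_congr_ae (Eventually.of_forall fun t => by ring)
    rw [esplit, hparts]
    have := hmain.trans hrhs
    linarith
  have hlim : f t₀ - c * t₀ ^ (-(m - 1)⁻¹) ≤ f t₁ - c * t₁ ^ (-(m - 1)⁻¹) := by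
    have hcont : ContinuousAt (fun t => f t - c * t ^ (-(m - 1)⁻¹)) t₁ :=
      hFc.continuousAt (Ioi_mem_nhds ht₁)
    refine ge_of_tendsto (hcont.tendsto.mono_left (nhdsWithin_le_nhds (s := Iio t₁))) ?_
    filter_upwards [Ico_mem_nhdsLT ht] with t htt using hmonoF t htt.1 htt.2
  have hpos : 0 ≤ c * t₁ ^ (-(m - 1)⁻¹) := mul_nonneg hc0 (Real.rpow_nonneg ht₁.le _)
  calc f t₀ - f t₁ ≤ c * t₀ ^ (-(m - 1)⁻¹) := by linarith
    _ = _ := by rw [hc]; ring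

end Green

lemma WeightCond.ae_pos {N : ℕ} {γ Cl Cu : ℝ} {ρ : Eu N → ℝ} (hρ : WeightCond N γ Cl Cu ρ) :
    ∀ᵐ x, 0 < ρ x := by
  obtain ⟨-, -, -, hCl, -, hb⟩ := hρ
  filter_upwards [hb] with x hx
  exact (mul_pos hCl (Real.rpow_pos_of_pos (by positivity) _)).trans_le hx.1

lemma WES.weightedFlow {N : ℕ} {γ Cl Cu m : ℝ} {ρ : Eu N → ℝ} {u : Eu N → ℝ → ℝ}
    {u₀ : Eu N → ℝ} {g : Eu N → ℝ → Eu N} (hW : WES ρ m u u₀ g)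
    (hρ : WeightCond N γ Cl Cu ρ) (hupos : ∀ t : ℝ, 0 ≤ t → ∀ᵐ x, 0 ≤ u x t)
    (hmass : ∀ t : ℝ, 0 < t → ∫ x, u x t * ρ x = ∫ x, u₀ x * ρ x) :
    ∃ M, WeightedFlow ρ u (∫ x, u₀ x * ρ x) M := by
  obtain ⟨M, hM⟩ := hW.bdd
  refine ⟨M, hρ.1, hρ.ae_pos, ?_, fun t ht => ?_, fun t ht => hupos t ht.le, hM,
    fun t ht => ?_, hmass, fun t ht => ?_⟩
  · have := hW.meas
    rw [restrict_univ_prod_Ioi] at this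
    exact this.aestronglyMeasurable
  · refine ((hW.int t ht.le).aestronglyMeasurable.mul
      hρ.1.inv.aestronglyMeasurable).congr ?_
    filter_upwards [hρ.ae_pos, hupos t ht.le] with x h0 hu
    simp only [Pi.mul_apply, Pi.inv_apply, abs_of_nonneg hu]
    exact mul_inv_cancel_right₀ h0.ne' _
  · refine (hW.int t ht.le).congr ?_
    filter_upwards [hupos t ht.le] with x hu
    rw [abs_of_nonneg hu]
  · have := hW.contL1 t ht.le
    rwa [nhdsWithin_eq_nhds.2 (Ici_mem_nhds ht)] at this

lemma ae_ne_of_pos_dim {N : ℕ} (hN : 0 < N) (x₀ : Eu N) : ∀ᵐ x : Eu N, x ≠ x₀ := by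
  have : Nonempty (Fin N) := ⟨⟨0, hN⟩⟩
  exact compl_mem_ae_iff.2 (measure_singleton x₀)

/-- **Proposition 3.2, estimate \eqref{flb equation}**: for a non-negative weak energy solution
with the listed extra properties (strong time derivative in `L^∞_loc((0,∞);L¹_ρ)`, the
Aronson–Bénilan inequality, the `L¹_ρ → L^∞` smoothing estimate, and mass conservation), the
fundamental Green-function inequality holds. -/
theorem stmt_8 {N : ℕ} (hN : 3 ≤ N) (m γ Cl Cu : ℝ) (hm : 1 < m)
    (ρ : Eu N → ℝ) (hρ : WeightCond N γ Cl Cu ρ)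
    (u₀ : Eu N → ℝ) (u : Eu N → ℝ → ℝ) (g : Eu N → ℝ → Eu N)
    (hWES : WES ρ m u u₀ g)
    (hu₀pos : ∀ᵐ x ∂(volume : Measure (Eu N)), 0 ≤ u₀ x)
    (hupos : ∀ t : ℝ, 0 ≤ t → ∀ᵐ x ∂(volume : Measure (Eu N)), 0 ≤ u x t)
    -- the strong time derivative `u_t ∈ L^∞_loc((0,∞); L¹_ρ(ℝ^N))`
    (w : Eu N → ℝ → ℝ)
    (hwderiv : ∀ φ : Eu N × ℝ → ℝ, ContDiff ℝ (⊤ : ℕ∞) φ → HasCompactSupport φ →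
      tsupport φ ⊆ (univ : Set (Eu N)) ×ˢ Ioi 0 →
      ∫ p in (univ : Set (Eu N)) ×ˢ Ioi (0:ℝ), u p.1 p.2 * ptder φ p * ρ p.1 =
        -∫ p in (univ : Set (Eu N)) ×ˢ Ioi (0:ℝ), w p.1 p.2 * φ p * ρ p.1)
    (hwloc : ∀ a b : ℝ, 0 < a → a < b →
      ∃ M : ℝ, ∀ᵐ t ∂(volume.restrict (Ioo a b) : Measure ℝ), ∫ x, |w x t| * ρ x ≤ M)
    -- the Aronson–Bénilan-type inequality \eqref{weak BC estimate}
    (hAB : ∀ᵐ p ∂(volume.restrict ((univ : Set (Eu N)) ×ˢ Ioi 0) : Measure (Eu N × ℝ)),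
      -(ρ p.1 * u p.1 p.2) / ((m - 1) * p.2) ≤ ρ p.1 * w p.1 p.2)
    -- the smoothing estimate \eqref{basic smoothing}
    (K : ℝ) (hK : 0 < K)
    (hsmooth : ∀ t : ℝ, 0 < t → ∀ᵐ x ∂(volume : Measure (Eu N)),
      |u x t| ≤ K * t ^ (-(lamC N γ m)) *
        (∫ y, |u₀ y| * ρ y) ^ (thetC N γ * lamC N γ m))
    -- mass conservation \eqref{mass cons}
    (hmass : ∀ t : ℝ, 0 < t → ∫ x, u x t * ρ x = ∫ x, u₀ x * ρ x) :
    ∀ t₀ t₁ : ℝ, 0 < t₀ → t₀ < t₁ →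
      ∀ᵐ x₀ ∂(volume : Measure (Eu N)),
        ∫ x, (u x t₀ - u x t₁) * GreenFn N x x₀ * ρ x ≤
          (m - 1) * t₁ ^ (m / (m - 1)) * t₀ ^ (-(1 / (m - 1))) * (u x₀ t₁) ^ m := by
  intro t₀ t₁ ht₀ ht
  have ht₁ : 0 < t₁ := ht₀.trans ht
  have hm1 : 0 < m - 1 := by linarith
  obtain ⟨M, h⟩ := hWES.weightedFlow hρ hupos hmass
  have hmono : ∀ t, 0 < t → t ≤ t₁ → ∀ᵐ x, t ^ (m - 1)⁻¹ * u x t ≤ t₁ ^ (m - 1)⁻¹ * u x t₁ :=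
    fun t h0 h1 => h.rpow_mul_le_rpow_mul hm hwderiv hAB h0 h1
  have hr : ∀ n : ℕ, 0 < 1 / ((n : ℝ) + 1) := fun n => by positivity
  have hr0 := tendsto_one_div_add_atTop_nhds_zero_nat (𝕜 := ℝ)
  have he : ∀ n : ℕ, 0 < (1 / ((n : ℝ) + 1)) ^ 2 := fun n => pow_pos (hr n) 2
  have he0 : Tendsto (fun n : ℕ => (1 / ((n : ℝ) + 1)) ^ 2) atTop (𝓝 0) := by
    simpa using hr0.pow 2
  rw [show m / (m - 1) = 1 + (m - 1)⁻¹ by field_simp; ring, one_div]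
  have hC : 0 ≤ (m - 1) * t₁ ^ (1 + (m - 1)⁻¹) * t₀ ^ (-(m - 1)⁻¹) :=
    mul_nonneg (mul_nonneg hm1.le (Real.rpow_nonneg ht₁.le _)) (Real.rpow_nonneg ht₀.le _)
  filter_upwards [ae_tendsto_integral_mul_greenKer (h.aesm_spow_slice m ht₁)
    ((h.spow_slice hm ht₁).mono fun _ hx => hx.2.2) hr hr0, h.spow_slice hm ht₁] with x₀ hlim hx₀
  rw [← hx₀.2.1]
  by_cases hi : Integrable fun x => (u x t₀ - u x t₁) * GreenFn N x x₀ * ρ x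
  swap
  · rw [integral_undef hi]
    exact mul_nonneg hC hx₀.1
  have hne := ae_ne_of_pos_dim (by omega : 0 < N) x₀
  have hcont := fun n : ℕ => (contDiff_truncGreen (N := N) (δ := (1 / ((n : ℝ) + 1)) ^ 2)
    (he n) x₀).continuous
  have hsl : ∀ t, 0 < t → ∀ n : ℕ, Integrable fun x => u x t *
      truncGreen N ((1 / ((n : ℝ) + 1)) ^ 2) ((1 / ((n : ℝ) + 1)) ^ 2) (‖x - x₀‖ ^ 2) * ρ x :=
    fun t h0 n => by
      obtain ⟨C, hC⟩ := (hasCompactSupport_truncGreen hN (he n) _ x₀).exists_bound_of_continuous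
        (hcont n)
      exact h.integrable_mul_slice h0 (hcont n).aestronglyMeasurable hC
  refine le_of_tendsto_of_tendsto' (tendsto_integral_of_dominated_convergence
    (F := fun (n : ℕ) x => (u x t₀ - u x t₁) *
      truncGreen N ((1 / ((n : ℝ) + 1)) ^ 2) ((1 / ((n : ℝ) + 1)) ^ 2) (‖x - x₀‖ ^ 2) * ρ x)
    (fun x => ‖(u x t₀ - u x t₁) * GreenFn N x x₀ * ρ x‖) (fun n => ?_) hi.norm (fun n => ?_) ?_)
    (hlim.const_mul _) fun n => ?_
  · simp only [sub_mul]
    exact ((hsl t₀ ht₀ n).sub (hsl t₁ ht₁ n)).aestronglyMeasurable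
  · filter_upwards [hne] with x hx
    have h1 := truncGreen_nonneg hN (he n) (he n) (by positivity : 0 ≤ ‖x - x₀‖ ^ 2)
    have h2 := (truncGreen_le hN (he n) (he n) (by positivity : 0 ≤ ‖x - x₀‖ ^ 2)).trans
      (greenReg_le_green hN (he n) hx)
    simp only [norm_mul]
    gcongr
    rwa [Real.norm_of_nonneg h1, Real.norm_of_nonneg (h1.trans h2)]
  · filter_upwards [hne] with x hx
    exact ((tendsto_truncGreen hN he he0 hx).const_mul _).mul_const _
  · refine le_trans (le_of_eq ?_) (hWES.integral_truncGreen_sub_le h hm hN ht₀ ht hmono (he n)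
      (hr n) x₀)
    rw [← integral_sub (hsl t₀ ht₀ n) (hsl t₁ ht₁ n)]
    exact integral_congr_ae (Eventually.of_forall fun x => by ring)
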